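/- arXiv:1204.2909 — 3 statements merged into one kernel-verified Lean document; each statement's English description precedes it below -/
import Mathlib

section
/- Under the stated density-regulation assumptions, there exist an open set W ⊆ ℝ^q containing U_eq and a twice continuously differentiable function Λ : W → ℝ^q such that: (i) every component of Λ(h) is strictly positive for every h ∈ W; (ii) Λ(h_eq) = v_eq; (iii) for every h ∈ U_eq, A(h)ᵀ Λ(h) + [JΛ(h)] θ(h) = 0; and (iv) ⟨Λ(h), h⟩ = 1 for every h ∈ U_eq. -/
/-- The interaction matrix `A(h)` with entries `A_{ij}(h) = β_{ji}(h)` for `i ≠ j`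
and `A_{ii}(h) = β_{ii}(h) − ρ_i(h)`. -/
noncomputable def interactionMatrix (q : ℕ) (β : Fin q → Fin q → (Fin q → ℝ) → ℝ)
    (ρ : Fin q → (Fin q → ℝ) → ℝ) (h : Fin q → ℝ) : Matrix (Fin q) (Fin q) ℝ :=
  Matrix.of fun i j => if i = j then β i i h - ρ i h else β j i h

/-- The density-regulation vector field `θ(h) = A(h) h`. -/
noncomputable def densityField (q : ℕ) (β : Fin q → Fin q → (Fin q → ℝ) → ℝ)
    (ρ : Fin q → (Fin q → ℝ) → ℝ) (h : Fin q → ℝ) : Fin q → ℝ :=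
  (interactionMatrix q β ρ h).mulVec h


namespace DensReg

open Set Filter Topology BoundedContinuousFunction
open scoped NNReal


set_option linter.unusedSectionVars false
set_option linter.unusedSimpArgs false
set_option linter.style.whitespace false

section Superposition

variable {α : Type*} [TopologicalSpace α]
variable {E F : Type*} [NormedAddCommGroup E] [NormedSpace ℝ E]
  [NormedAddCommGroup F] [NormedSpace ℝ F]

/-- Pointwise application of an operator-valued function. -/
noncomputable def multFun (B : α →ᵇ (E →L[ℝ] F)) (u : α →ᵇ E) : α →ᵇ F :=
  BoundedContinuousFunction.ofNormedAddCommGroup (fun t => B t (u t))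
    (B.continuous.clm_apply u.continuous) (‖B‖ * ‖u‖)
    (fun t => (ContinuousLinearMap.le_opNorm _ _).trans
      (mul_le_mul (B.norm_coe_le_norm t) (u.norm_coe_le_norm t) (norm_nonneg _) (norm_nonneg B)))

/-- Pointwise application as a continuous bilinear map. -/
noncomputable def mult (α E F : Type*) [TopologicalSpace α]
    [NormedAddCommGroup E] [NormedSpace ℝ E] [NormedAddCommGroup F] [NormedSpace ℝ F] :
    (α →ᵇ (E →L[ℝ] F)) →L[ℝ] (α →ᵇ E) →L[ℝ] (α →ᵇ F) :=
  LinearMap.mkContinuous₂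
    (LinearMap.mk₂ ℝ (multFun (α := α) (E := E) (F := F))
      (by intros; ext; simp [multFun]) (by intros; ext; simp [multFun])
      (by intros; ext; simp [multFun]) (by intros; ext; simp [multFun])) 1
    (by
      intro B u
      rw [one_mul]
      exact (BoundedContinuousFunction.norm_le (by positivity)).2 (fun t =>
        (ContinuousLinearMap.le_opNorm (B t) (u t)).trans
          (mul_le_mul (B.norm_coe_le_norm t) (u.norm_coe_le_norm t) (norm_nonneg _)
            (norm_nonneg B))))

@[simp] lemma mult_apply (B : α →ᵇ (E →L[ℝ] F)) (u : α →ᵇ E) (t : α) :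
    mult α E F B u t = B t (u t) := rfl

/-- A continuous function with compact support as a bounded continuous function. -/
noncomputable def toB (g : E → F) (hc : Continuous g) (hs : HasCompactSupport g) : E →ᵇ F :=
  BoundedContinuousFunction.ofNormedAddCommGroup g hc
    (Classical.choose (hs.exists_bound_of_continuous hc))
    (Classical.choose_spec (hs.exists_bound_of_continuous hc))

@[simp] lemma toB_apply (g : E → F) (hc : Continuous g) (hs : HasCompactSupport g) (x : E) :
    toB g hc hs x = g x := rfl

/-- Superposition operator. -/
noncomputable def sup0 (g : E →ᵇ F) (x : α →ᵇ E) : α →ᵇ F := g.compContinuous x.toContinuousMap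

@[simp] lemma sup0_apply (g : E →ᵇ F) (x : α →ᵇ E) (t : α) : sup0 g x t = g (x t) := rfl

lemma sup0_continuous (g : E →ᵇ F) (hg : UniformContinuous g) :
    Continuous (sup0 g : (α →ᵇ E) → (α →ᵇ F)) := by
  rw [Metric.continuous_iff]
  intro x ε hε
  obtain ⟨δ, hδ, h⟩ := Metric.uniformContinuous_iff.1 hg (ε / 2) (by positivity)
  refine ⟨δ, hδ, fun y hy => ?_⟩
  refine lt_of_le_of_lt ((BoundedContinuousFunction.dist_le (by positivity)).2 fun t => ?_)
    (half_lt_self hε)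
  exact (h (lt_of_le_of_lt (BoundedContinuousFunction.dist_coe_le_dist t) hy)).le

/-- The affine map `u ↦ e + w u`. -/
noncomputable def aff (e : E) (w : α →ᵇ ℝ) (u : α →ᵇ E) : α →ᵇ E :=
  BoundedContinuousFunction.const α e +
    mult α E E (BoundedContinuousFunction.ofNormedAddCommGroup
      (fun t => w t • ContinuousLinearMap.id ℝ E) (w.continuous.smul continuous_const)
      (‖w‖ * ‖ContinuousLinearMap.id ℝ E‖)
      (fun t => by
        rw [norm_smul]
        exact mul_le_mul_of_nonneg_right (w.norm_coe_le_norm t) (norm_nonneg _))) u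

@[simp] lemma aff_apply (e : E) (w : α →ᵇ ℝ) (u : α →ᵇ E) (t : α) :
    aff e w u t = e + w t • u t := rfl

lemma aff_contDiff (e : E) (w : α →ᵇ ℝ) {n : WithTop ℕ∞} : ContDiff ℝ n (aff (α := α) e w) := by
  unfold aff
  exact contDiff_const.add (ContinuousLinearMap.contDiff _)

/-- The weighted superposition operator `u ↦ w⁻¹ (f(e + w u) - f(e))`. -/
noncomputable def wsup (f : E → F) (L : ℝ≥0) (hf : LipschitzWith L f) (e : E) (w : α →ᵇ ℝ)
    (hw : ∀ t, 0 < w t) (u : α →ᵇ E) : α →ᵇ F :=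
  BoundedContinuousFunction.ofNormedAddCommGroup
    (fun t => (w t)⁻¹ • (f (e + w t • u t) - f e))
    ((w.continuous.inv₀ (fun t => (hw t).ne')).smul
      ((hf.continuous.comp (continuous_const.add (w.continuous.smul u.continuous))).sub
        continuous_const)) (L * ‖u‖)
    (fun t => by
      have h1 := hf.dist_le_mul (e + w t • u t) e
      rw [dist_eq_norm, dist_eq_norm, add_sub_cancel_left, norm_smul, Real.norm_of_nonneg (hw t).le]
        at h1
      rw [norm_smul, norm_inv, Real.norm_of_nonneg (hw t).le, inv_mul_le_iff₀ (hw t)]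
      have h2 := u.norm_coe_le_norm t
      have h3 : w t * ‖u t‖ ≤ w t * ‖u‖ := mul_le_mul_of_nonneg_left h2 (hw t).le
      have : (L : ℝ) * (w t * ‖u t‖) ≤ L * (w t * ‖u‖) := mul_le_mul_of_nonneg_left h3 L.2
      nlinarith)

@[simp] lemma wsup_apply (f : E → F) (L : ℝ≥0) (hf : LipschitzWith L f) (e : E) (w : α →ᵇ ℝ)
    (hw : ∀ t, 0 < w t) (u : α →ᵇ E) (t : α) :
    wsup f L hf e w hw u t = (w t)⁻¹ • (f (e + w t • u t) - f e) := rfl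

lemma unifCont {g : E → F} (hc : Continuous g) (hs : HasCompactSupport g) :
    UniformContinuous g := hs.uniformContinuous_of_continuous hc

lemma wsup_hasFDerivAt (f : E → F) (L : ℝ≥0) (hf : LipschitzWith L f) (e : E) (w : α →ᵇ ℝ)
    (hw : ∀ t, 0 < w t) (hC : ContDiff ℝ 1 f) (hs : HasCompactSupport f) (u : α →ᵇ E) :
    HasFDerivAt (wsup f L hf e w hw)
      (mult α E F (sup0 (toB (fderiv ℝ f) (hC.continuous_fderiv one_ne_zero) (hs.fderiv ℝ))
        (aff e w u))) u := by
  have hu := unifCont (hC.continuous_fderiv one_ne_zero) (hs.fderiv ℝ)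
  rw [hasFDerivAt_iff_isLittleO, Asymptotics.isLittleO_iff]
  intro ε hε
  obtain ⟨δ, hδ, h⟩ := Metric.uniformContinuous_iff.1 hu ε hε
  have hball : Metric.ball u (δ / (‖w‖ + 1)) ∈ 𝓝 u := Metric.ball_mem_nhds _ (by positivity)
  filter_upwards [hball] with v hv
  rw [Metric.mem_ball, dist_eq_norm, lt_div_iff₀ (by positivity)] at hv
  refine (BoundedContinuousFunction.norm_le (by positivity)).2 fun t => ?_
  have hwt := hw t
  have hwn : w t ≤ ‖w‖ := (le_abs_self _).trans (w.norm_coe_le_norm t)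
  have hvt : ‖v t - u t‖ ≤ ‖v - u‖ := (v - u).norm_coe_le_norm t
  have key := Convex.norm_image_sub_le_of_norm_fderiv_le' (𝕜 := ℝ) (f := f)
    (s := Metric.ball (e + w t • u t) δ) (φ := fderiv ℝ f (e + w t • u t)) (C := ε)
    (x := e + w t • u t) (y := e + w t • v t)
    (fun x _ => (hC.differentiable one_ne_zero) x)
    (fun x hx => by rw [← dist_eq_norm]; exact (h hx).le)
    (convex_ball _ _) (Metric.mem_ball_self hδ)
    (by
      rw [Metric.mem_ball, dist_eq_norm, add_sub_add_left_eq_sub, ← smul_sub, norm_smul,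
        Real.norm_of_nonneg hwt.le]
      have : w t * ‖v t - u t‖ ≤ ‖w‖ * ‖v - u‖ := mul_le_mul hwn hvt (norm_nonneg _) (norm_nonneg _)
      nlinarith [norm_nonneg (v - u)])
  rw [add_sub_add_left_eq_sub, ← smul_sub, norm_smul, Real.norm_of_nonneg hwt.le] at key
  have e1 : (wsup f L hf e w hw v - wsup f L hf e w hw u -
      (mult α E F (sup0 (toB (fderiv ℝ f) (hC.continuous_fderiv one_ne_zero) (hs.fderiv ℝ))
        (aff e w u))) (v - u)) t = (w t)⁻¹ • (f (e + w t • v t) - f (e + w t • u t) -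
        fderiv ℝ f (e + w t • u t) (w t • (v t - u t))) := by
    simp only [BoundedContinuousFunction.coe_sub, Pi.sub_apply, wsup_apply, mult_apply, sup0_apply,
      toB_apply, aff_apply]
    rw [(fderiv ℝ f (e + w t • u t)).map_smul, smul_sub _ _ ((w t) • _), inv_smul_smul₀ hwt.ne',
      ← smul_sub]
    congr 2
    abel
  rw [e1, norm_smul, norm_inv, Real.norm_of_nonneg hwt.le, inv_mul_le_iff₀ hwt]
  refine key.trans ?_
  have : w t * ‖v t - u t‖ ≤ w t * ‖v - u‖ := mul_le_mul_of_nonneg_left hvt hwt.le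
  nlinarith

lemma sup0_contDiff_one {g : E → F} (hC : ContDiff ℝ 1 g) (hs : HasCompactSupport g) :
    ContDiff ℝ 1 (sup0 (toB g hC.continuous hs) : (α →ᵇ E) → (α →ᵇ F)) := by
  obtain ⟨L, hL⟩ := hC.lipschitzWith_of_hasCompactSupport hs one_ne_zero
  have hw : ∀ t : α, 0 < (BoundedContinuousFunction.const α (1 : ℝ)) t := fun t => by simp
  have e1 : (sup0 (toB g hC.continuous hs) : (α →ᵇ E) → (α →ᵇ F)) =
      fun u => wsup g L hL 0 (BoundedContinuousFunction.const α (1 : ℝ)) hw u +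
        BoundedContinuousFunction.const α (g 0) := by
    funext u; ext t; simp
  rw [e1]
  refine ContDiff.add ?_ contDiff_const
  rw [contDiff_one_iff_hasFDerivAt]
  refine ⟨_, ?_, fun u => wsup_hasFDerivAt g L hL 0 _ hw hC hs u⟩
  exact (mult α E F).continuous.comp ((sup0_continuous _
    (unifCont (hC.continuous_fderiv one_ne_zero) (hs.fderiv ℝ))).comp
      (aff_contDiff (n := 0) _ _).continuous)

lemma wsup_contDiff (f : E → F) (L : ℝ≥0) (hf : LipschitzWith L f) (e : E) (w : α →ᵇ ℝ)
    (hw : ∀ t, 0 < w t) (hC : ContDiff ℝ 2 f) (hs : HasCompactSupport f) :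
    ContDiff ℝ 2 (wsup f L hf e w hw) := by
  have hC1 : ContDiff ℝ 1 f := hC.of_le one_le_two
  have h2 : (2 : WithTop ℕ∞) = ((1 : ℕ) : WithTop ℕ∞) + 1 := by norm_num
  rw [h2, contDiff_succ_iff_hasFDerivAt]
  refine ⟨_, ?_, fun u => wsup_hasFDerivAt f L hf e w hw hC1 hs u⟩
  have hD : ContDiff ℝ 1 (fderiv ℝ f) := hC.fderiv_right (by norm_num)
  exact (mult α E F).contDiff.comp ((sup0_contDiff_one hD (hs.fderiv ℝ)).comp (aff_contDiff _ _))

end Superposition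

end DensReg


namespace DensReg

open Set Filter Topology BoundedContinuousFunction MeasureTheory
open scoped NNReal


set_option linter.unusedSectionVars false
set_option linter.unusedSimpArgs false

section Kernels

variable {E : Type*} [NormedAddCommGroup E] [NormedSpace ℝ E] [CompleteSpace E]

/-- The operator exponential `exp (t J)`. -/
noncomputable def ex (J : E →L[ℝ] E) (t : ℝ) : E →L[ℝ] E := NormedSpace.exp (t • J)

lemma ex_hasDerivAt (J : E →L[ℝ] E) (t : ℝ) : HasDerivAt (ex J) (J * ex J t) t :=
  hasDerivAt_exp_smul_const' J t

lemma ex_hasDerivAt' (J : E →L[ℝ] E) (t : ℝ) : HasDerivAt (ex J) (ex J t * J) t :=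
  hasDerivAt_exp_smul_const J t

lemma ex_continuous (J : E →L[ℝ] E) : Continuous (ex J) :=
  continuous_iff_continuousAt.2 fun t => (ex_hasDerivAt J t).continuousAt

lemma ex_zero (J : E →L[ℝ] E) : ex J 0 = 1 := by
  simp [ex, NormedSpace.exp_zero]

lemma ex_add (J : E →L[ℝ] E) (s t : ℝ) : ex J (s + t) = ex J s * ex J t := by
  unfold ex
  rw [add_smul]
  exact NormedSpace.exp_add_of_commute_of_mem_ball (𝕂 := ℝ)
    (((Commute.refl J).smul_left s).smul_right t)
    ((NormedSpace.expSeries_radius_eq_top ℝ (E →L[ℝ] E)).symm ▸ edist_lt_top _ _)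
    ((NormedSpace.expSeries_radius_eq_top ℝ (E →L[ℝ] E)).symm ▸ edist_lt_top _ _)

lemma ex_add_apply (J : E →L[ℝ] E) (s t : ℝ) (x : E) : ex J s (ex J t x) = ex J (s + t) x := by
  rw [ex_add]; rfl

lemma ex_neg_apply (J : E →L[ℝ] E) (t : ℝ) (x : E) : ex J t (ex J (-t) x) = x := by
  rw [ex_add_apply]; simp [ex_zero]

lemma ex_neg_apply' (J : E →L[ℝ] E) (t : ℝ) (x : E) : ex J (-t) (ex J t x) = x := by
  rw [ex_add_apply]; simp [ex_zero]

/-- Forward Duhamel integral. -/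
noncomputable def fwd (J : E →L[ℝ] E) (F : ℝ → E) (t : ℝ) : E :=
  ex J t (∫ s in (0 : ℝ)..t, ex J (-s) (F s))

lemma ex_neg_continuous (J : E →L[ℝ] E) {F : ℝ → E} (hF : Continuous F) :
    Continuous fun s => ex J (-s) (F s) :=
  ((ex_continuous J).comp continuous_neg).clm_apply hF

lemma ex_app_continuous (J : E →L[ℝ] E) {F : ℝ → E} (hF : Continuous F) :
    Continuous fun s => ex J s (F s) :=
  (ex_continuous J).clm_apply hF

lemma fwd_hasDerivAt (J : E →L[ℝ] E) {F : ℝ → E} (hF : Continuous F) (t : ℝ) :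
    HasDerivAt (fwd J F) (J (fwd J F t) + F t) t := by
  have h1 : HasDerivAt (fun t => ∫ s in (0 : ℝ)..t, ex J (-s) (F s)) (ex J (-t) (F t)) t :=
    (ex_neg_continuous J hF).integral_hasStrictDerivAt 0 t |>.hasDerivAt
  have := (ex_hasDerivAt J t).clm_apply h1
  rw [ex_neg_apply] at this
  exact this

lemma fwd_zero (J : E →L[ℝ] E) (F : ℝ → E) : fwd J F 0 = 0 := by simp [fwd]

lemma fwd_continuous (J : E →L[ℝ] E) {F : ℝ → E} (hF : Continuous F) : Continuous (fwd J F) :=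
  continuous_iff_continuousAt.2 fun t => (fwd_hasDerivAt J hF t).continuousAt

lemma fwd_congr (J : E →L[ℝ] E) {F G : ℝ → E} {t : ℝ} (ht : 0 ≤ t)
    (h : ∀ s, 0 ≤ s → F s = G s) : fwd J F t = fwd J G t := by
  unfold fwd
  congr 1
  refine intervalIntegral.integral_congr fun s hs => ?_
  rw [uIcc_of_le ht] at hs
  simp only [h s hs.1]

lemma fwd_add (J : E →L[ℝ] E) {F G : ℝ → E} (hF : Continuous F) (hG : Continuous G) (t : ℝ) :
    fwd J (fun s => F s + G s) t = fwd J F t + fwd J G t := by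
  unfold fwd
  rw [← map_add, ← intervalIntegral.integral_add]
  · simp
  · exact (ex_neg_continuous J hF).intervalIntegrable _ _
  · exact (ex_neg_continuous J hG).intervalIntegrable _ _

lemma fwd_smul (J : E →L[ℝ] E) {F : ℝ → E} (a t : ℝ) :
    fwd J (fun s => a • F s) t = a • fwd J F t := by
  unfold fwd
  rw [← map_smul, ← intervalIntegral.integral_smul]
  simp

lemma fwd_eq (J : E →L[ℝ] E) {F : ℝ → E} (hF : Continuous F) (t : ℝ) :
    fwd J F t = ∫ s in (0 : ℝ)..t, ex J (t - s) (F s) := by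
  unfold fwd
  rw [← ContinuousLinearMap.intervalIntegral_comp_comm _
    ((ex_neg_continuous J hF).intervalIntegrable _ _)]
  simp only [ex_add_apply, sub_eq_add_neg]

lemma fwd_bound (J : E →L[ℝ] E) {F : ℝ → E} (hF : Continuous F) {K c : ℝ}
    (hJ : ∀ r, 0 ≤ r → ‖ex J r‖ ≤ K * Real.exp (-c * r)) {f : ℝ → ℝ} (hf : Continuous f) {t : ℝ}
    (ht : 0 ≤ t) (hFf : ∀ s, 0 ≤ s → s ≤ t → ‖F s‖ ≤ f s) :
    ‖fwd J F t‖ ≤ ∫ s in (0 : ℝ)..t, K * Real.exp (-c * (t - s)) * f s := by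
  rw [fwd_eq J hF]
  refine intervalIntegral.norm_integral_le_of_norm_le ht (Eventually.of_forall fun s hs => ?_) ?_
  · refine (ContinuousLinearMap.le_opNorm _ _).trans ?_
    have h1 := hJ (t - s) (by linarith [hs.2])
    exact mul_le_mul h1 (hFf s hs.1.le hs.2) (norm_nonneg _) ((norm_nonneg _).trans h1)
  · apply Continuous.intervalIntegrable
    fun_prop

/-- The weight function. -/
noncomputable def wt (K c b D t : ℝ) : ℝ :=
  Real.exp (-(c - 2 * K * b) * t) * Real.exp (-(2 * K * D) * Real.exp (-t))

lemma wt_pos (K c b D t : ℝ) : 0 < wt K c b D t := by unfold wt; positivity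

lemma wt_continuous (K c b D : ℝ) : Continuous (wt K c b D) := by unfold wt; fun_prop

lemma wt_integral (K c b D t : ℝ) :
    ∫ s in (0 : ℝ)..t, K * Real.exp (-c * (t - s)) * ((b + D * Real.exp (-s)) * wt K c b D s)
      ≤ wt K c b D t / 2 := by
  have hd : ∀ s ∈ uIcc 0 t, HasDerivAt
      (fun s => Real.exp (-c * t) / 2 *
        Real.exp (2 * K * b * s - (2 * K * D) * Real.exp (-s)))
      (K * Real.exp (-c * (t - s)) * ((b + D * Real.exp (-s)) * wt K c b D s)) s := by
    intro s _
    have h1 : HasDerivAt (fun s : ℝ => Real.exp (-s)) (-Real.exp (-s)) s := by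
      simpa using (hasDerivAt_neg s).exp
    have h2 : HasDerivAt (fun s : ℝ => 2 * K * b * s - (2 * K * D) * Real.exp (-s))
        (2 * K * b * 1 - (2 * K * D) * (-Real.exp (-s))) s :=
      ((hasDerivAt_id s).const_mul _).sub (h1.const_mul _)
    have h3 := (h2.exp).const_mul (Real.exp (-c * t) / 2)
    convert! h3 using 1
    have e1 : K * Real.exp (-c * (t - s)) * ((b + D * Real.exp (-s)) * wt K c b D s)
      = (K * (b + D * Real.exp (-s))) * (Real.exp (-c * (t - s)) * wt K c b D s) := by ring
    have e2 : Real.exp (-c * (t - s)) * wt K c b D s =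
        Real.exp (-c * t) * Real.exp (2 * K * b * s - 2 * K * D * Real.exp (-s)) := by
      unfold wt
      rw [← Real.exp_add, ← Real.exp_add, ← Real.exp_add]
      congr 1; ring
    rw [e1, e2]; ring
  rw [intervalIntegral.integral_eq_sub_of_hasDerivAt hd]
  · have e3 : Real.exp (-c * t) / 2 *
        Real.exp (2 * K * b * t - (2 * K * D) * Real.exp (-t)) = wt K c b D t / 2 := by
      unfold wt
      rw [← Real.exp_add, div_mul_eq_mul_div, ← Real.exp_add]
      congr 2; ring
    rw [e3]
    have : 0 ≤ Real.exp (-c * t) / 2 *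
        Real.exp (2 * K * b * 0 - (2 * K * D) * Real.exp (-0)) := by positivity
    linarith
  · apply Continuous.intervalIntegrable
    have := wt_continuous K c b D
    fun_prop

lemma fwd_wt_bound (J : E →L[ℝ] E) {F : ℝ → E} (hF : Continuous F) {K c b D G : ℝ}
    (hJ : ∀ r, 0 ≤ r → ‖ex J r‖ ≤ K * Real.exp (-c * r)) {t : ℝ} (ht : 0 ≤ t) (hG : 0 ≤ G)
    (hFf : ∀ s, 0 ≤ s → s ≤ t → ‖F s‖ ≤ (b + D * Real.exp (-s)) * wt K c b D s * G) :
    ‖fwd J F t‖ ≤ wt K c b D t * (G / 2) := by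
  have hw := wt_continuous K c b D
  have h1 := fwd_bound J hF hJ (f := fun s => (b + D * Real.exp (-s)) * wt K c b D s * G)
    (by fun_prop) ht hFf
  have h2 : ∫ s in (0 : ℝ)..t, K * Real.exp (-c * (t - s)) *
        ((b + D * Real.exp (-s)) * wt K c b D s * G) =
      (∫ s in (0 : ℝ)..t, K * Real.exp (-c * (t - s)) *
        ((b + D * Real.exp (-s)) * wt K c b D s)) * G := by
    rw [← intervalIntegral.integral_mul_const]
    congr 1; funext s; ring
  rw [h2] at h1
  have h3 := mul_le_mul_of_nonneg_right (wt_integral K c b D t) hG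
  linarith

/-- Data for the forward problem. -/
structure FwdData (J : E →L[ℝ] E) (K c b D : ℝ) : Prop where
  hJ : ∀ r, 0 ≤ r → ‖ex J r‖ ≤ K * Real.exp (-c * r)
  hK : 0 < K
  hb : 0 < b
  hD : 0 ≤ D
  hc : 2 * K * b < c

variable {J : E →L[ℝ] E} {K c b D : ℝ}

lemma wt_le_exp (hd : FwdData J K c b D) (t : ℝ) :
    wt K c b D t ≤ Real.exp (-(c - 2 * K * b) * t) := by
  unfold wt
  refine mul_le_of_le_one_right (by positivity) ?_
  rw [Real.exp_le_one_iff]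
  have := hd.hK; have := hd.hD
  have : 0 ≤ 2 * K * D * Real.exp (-t) := by positivity
  linarith

lemma wt_le_one (hd : FwdData J K c b D) {t : ℝ} (ht : 0 ≤ t) : wt K c b D t ≤ 1 := by
  refine (wt_le_exp hd t).trans ?_
  rw [Real.exp_le_one_iff]
  have := hd.hc
  nlinarith

/-- The clamped weight as bounded continuous function. -/
noncomputable def wtB (hd : FwdData J K c b D) : ℝ →ᵇ ℝ :=
  BoundedContinuousFunction.ofNormedAddCommGroup (fun t => wt K c b D (max t 0))
    ((wt_continuous K c b D).comp (continuous_id.max continuous_const)) 1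
    (fun t => by
      rw [Real.norm_of_nonneg (wt_pos _ _ _ _ _).le]
      exact wt_le_one hd (le_max_right _ _))

@[simp] lemma wtB_apply (hd : FwdData J K c b D) (t : ℝ) :
    wtB hd t = wt K c b D (max t 0) := rfl

lemma V_cont {g : ℝ → E} (hg : Continuous g) : Continuous (fun t : ℝ => (wt K c b D (max t 0))⁻¹ •
    fwd J (fun s => wt K c b D s • g s) (max t 0)) := by
  have hw := wt_continuous K c b D
  have hm : Continuous fun t : ℝ => max t 0 := continuous_id.max continuous_const
  refine ((hw.comp hm).inv₀ fun t => (wt_pos _ _ _ _ _).ne').smul ?_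
  exact (fwd_continuous J (hw.smul hg)).comp hm

lemma V_bd (hd : FwdData J K c b D) {g : ℝ → E} (hg : Continuous g) {G : ℝ} (hG : 0 ≤ G)
    (hgG : ∀ s, 0 ≤ s → ‖g s‖ ≤ (b + D * Real.exp (-s)) * G) (t : ℝ) :
    ‖(wt K c b D (max t 0))⁻¹ • fwd J (fun s => wt K c b D s • g s) (max t 0)‖ ≤ G / 2 := by
  have hw := wt_continuous K c b D
  have hp := wt_pos K c b D (max t 0)
  rw [norm_smul, norm_inv, Real.norm_of_nonneg hp.le, inv_mul_le_iff₀ hp]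
  have hF : Continuous (fun s => wt K c b D s • g s) := hw.smul hg
  refine fwd_wt_bound J hF hd.hJ (le_max_right _ _) hG fun s hs _ => ?_
  have hp := wt_pos K c b D s
  rw [norm_smul, Real.norm_of_nonneg hp.le]
  have := mul_le_mul_of_nonneg_left (hgG s hs) hp.le
  linarith

/-- The weighted Volterra operator. -/
noncomputable def V (hd : FwdData J K c b D) : (ℝ →ᵇ E) →L[ℝ] (ℝ →ᵇ E) :=
  have key : ∀ (g : ℝ →ᵇ E) (t : ℝ), ‖(wt K c b D (max t 0))⁻¹ •
      fwd J (fun s => wt K c b D s • g s) (max t 0)‖ ≤ (2 * b)⁻¹ * ‖g‖ := fun g t => by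
    have hb := hd.hb
    have hD := hd.hD
    refine (V_bd hd g.continuous (G := ‖g‖ / b) (by positivity) (fun s _ => ?_) t).trans ?_
    · refine (g.norm_coe_le_norm s).trans ?_
      have : 0 ≤ D * Real.exp (-s) * (‖g‖ / b) := by positivity
      have h2 : b * (‖g‖ / b) = ‖g‖ := by field_simp
      nlinarith
    · apply le_of_eq; field_simp
  LinearMap.mkContinuous
    { toFun := fun g => BoundedContinuousFunction.ofNormedAddCommGroup _
        (V_cont (J := J) (K := K) (c := c) (b := b) (D := D) g.continuous)
        ((2 * b)⁻¹ * ‖g‖) (key g)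
      map_add' := fun g h => by
        ext t
        have hw := wt_continuous K c b D
        have h1 : Continuous (fun s => wt K c b D s • g s) := hw.smul g.continuous
        have h2 : Continuous (fun s => wt K c b D s • h s) := hw.smul h.continuous
        have := fwd_add J h1 h2 (max t 0)
        simp only [BoundedContinuousFunction.coe_ofNormedAddCommGroup,
          BoundedContinuousFunction.coe_add, Pi.add_apply, smul_add] at this ⊢
        rw [this, smul_add]
      map_smul' := fun a g => by
        ext t
        have := fwd_smul J (F := fun s => wt K c b D s • g s) a (max t 0)
        simp only [BoundedContinuousFunction.coe_ofNormedAddCommGroup, RingHom.id_apply,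
          BoundedContinuousFunction.coe_smul, Pi.smul_apply, smul_comm _ a] at this ⊢
        rw [this, smul_comm] }
    (2 * b)⁻¹
    (fun g => BoundedContinuousFunction.norm_ofNormedAddCommGroup_le _
      (by have := hd.hb; positivity) (key g))

lemma V_apply (hd : FwdData J K c b D) (g : ℝ →ᵇ E) (t : ℝ) :
    V hd g t = (wt K c b D (max t 0))⁻¹ • fwd J (fun s => wt K c b D s • g s) (max t 0) := rfl

lemma V_norm_le (hd : FwdData J K c b D) (g : ℝ →ᵇ E) {G : ℝ} (hG : 0 ≤ G)
    (hgG : ∀ s, 0 ≤ s → ‖g s‖ ≤ (b + D * Real.exp (-s)) * G) : ‖V hd g‖ ≤ G / 2 :=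
  (BoundedContinuousFunction.norm_le (by positivity)).2 fun t => V_bd hd g.continuous hG hgG t

lemma iota_bd (hd : FwdData J K c b D) (k : E) (t : ℝ) :
    ‖(wt K c b D (max t 0))⁻¹ • ex J (max t 0) k‖ ≤ K * Real.exp (2 * K * D) * ‖k‖ := by
  set r := max t 0 with hr
  have hr0 : 0 ≤ r := le_max_right _ _
  have hp := wt_pos K c b D r
  have hK := hd.hK; have hD := hd.hD; have hb := hd.hb
  rw [norm_smul, norm_inv, Real.norm_of_nonneg hp.le, inv_mul_le_iff₀ hp]
  refine (ContinuousLinearMap.le_opNorm _ _).trans ?_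
  rw [← mul_assoc]
  refine mul_le_mul_of_nonneg_right ((hd.hJ r hr0).trans ?_) (norm_nonneg _)
  rw [mul_left_comm]
  refine mul_le_mul_of_nonneg_left ?_ hK.le
  unfold wt
  rw [← Real.exp_add, ← Real.exp_add, Real.exp_le_exp]
  have h1 : Real.exp (-r) ≤ 1 := by rw [Real.exp_le_one_iff]; linarith
  have h2 : 2 * K * D * Real.exp (-r) ≤ 2 * K * D * 1 :=
    mul_le_mul_of_nonneg_left h1 (by positivity)
  have h3 : 0 ≤ 2 * K * b * r := by positivity
  nlinarith

/-- Initial data embedding. -/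
noncomputable def iota (hd : FwdData J K c b D) : E →L[ℝ] (ℝ →ᵇ E) :=
  LinearMap.mkContinuous
    { toFun := fun k => BoundedContinuousFunction.ofNormedAddCommGroup
        (fun t : ℝ => (wt K c b D (max t 0))⁻¹ • ex J (max t 0) k)
        (by
          have hw := wt_continuous K c b D
          have hm : Continuous fun t : ℝ => max t 0 := continuous_id.max continuous_const
          refine ((hw.comp hm).inv₀ fun t => (wt_pos _ _ _ _ _).ne').smul ?_
          exact ((ex_continuous J).comp hm).clm_apply continuous_const)
        (K * Real.exp (2 * K * D) * ‖k‖) (iota_bd hd k)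
      map_add' := fun g h => by ext t; simp
      map_smul' := fun a g => by ext t; simp [smul_comm _ a] }
    (K * Real.exp (2 * K * D))
    (fun g => BoundedContinuousFunction.norm_ofNormedAddCommGroup_le _
      (by have := hd.hK; positivity) (iota_bd hd g))

lemma iota_apply (hd : FwdData J K c b D) (k : E) (t : ℝ) :
    iota hd k t = (wt K c b D (max t 0))⁻¹ • ex J (max t 0) k := rfl

end Kernels

end DensReg


namespace DensReg

open Set Filter Topology BoundedContinuousFunction MeasureTheory
open scoped NNReal


set_option linter.unusedSectionVars false
set_option linter.unusedSimpArgs false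

section Backward

variable {E : Type*} [NormedAddCommGroup E] [NormedSpace ℝ E] [CompleteSpace E]

/-- Backward Duhamel integral. -/
noncomputable def bwd (M : E →L[ℝ] E) (F : ℝ → E) (t : ℝ) : E :=
  ex M (-t) ((∫ s in Ioi (0 : ℝ), ex M s (F s)) - ∫ s in (0 : ℝ)..t, ex M s (F s))

lemma bwd_hasDerivAt (M : E →L[ℝ] E) {F : ℝ → E} (hF : Continuous F) (t : ℝ) :
    HasDerivAt (bwd M F) (-(M (bwd M F t)) - F t) t := by
  have h1 : HasDerivAt (fun t => (∫ s in Ioi (0 : ℝ), ex M s (F s)) -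
      ∫ s in (0 : ℝ)..t, ex M s (F s)) (-(ex M t (F t))) t :=
    ((ex_app_continuous M hF).integral_hasStrictDerivAt 0 t |>.hasDerivAt).const_sub _
  have h2 : HasDerivAt (fun t => ex M (-t)) (-(M * ex M (-t))) t := by
    have := (ex_hasDerivAt M (-t)).scomp t (hasDerivAt_neg t)
    rw [neg_one_smul] at this
    exact this
  have := h2.clm_apply h1
  convert! this using 1
  simp only [map_neg, ex_neg_apply', _root_.neg_apply, mul_apply_eq_comp]
  unfold bwd
  abel

lemma bwd_continuous (M : E →L[ℝ] E) {F : ℝ → E} (hF : Continuous F) : Continuous (bwd M F) :=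
  continuous_iff_continuousAt.2 fun t => (bwd_hasDerivAt M hF t).continuousAt

/-- Data for the backward problem. -/
structure BwdData (M : E →L[ℝ] E) (K C c : ℝ) (w : ℝ → ℝ) : Prop where
  hM : ∀ r, 0 ≤ r → ‖ex M r‖ ≤ K
  hK : 0 < K
  hC : 0 < C
  hc : 0 < c
  hwc : Continuous w
  hw : ∀ s, 0 ≤ s → |w s| ≤ Real.exp (-c * s)

/-- Backward weight. -/
noncomputable def w2 (K C c t : ℝ) : ℝ := Real.exp ((2 * K * C / c) * Real.exp (-c * t))

lemma w2_pos (K C c t : ℝ) : 0 < w2 K C c t := Real.exp_pos _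

lemma w2_continuous (K C c : ℝ) : Continuous (w2 K C c) := by unfold w2; fun_prop

variable {M : E →L[ℝ] E} {K C c : ℝ} {w : ℝ → ℝ}

lemma w2_one_le (bd : BwdData M K C c w) (t : ℝ) : 1 ≤ w2 K C c t := by
  have := bd.hK; have := bd.hC; have := bd.hc
  exact Real.one_le_exp (by positivity)

lemma w2_le (bd : BwdData M K C c w) {t : ℝ} (ht : 0 ≤ t) :
    w2 K C c t ≤ Real.exp (2 * K * C / c) := by
  have := bd.hK; have := bd.hC; have := bd.hc
  unfold w2
  rw [Real.exp_le_exp]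
  refine mul_le_of_le_one_right (by positivity) ?_
  rw [Real.exp_le_one_iff]
  nlinarith

lemma w2_hasDerivAt (hc : c ≠ 0) (t : ℝ) :
    HasDerivAt (fun t => -(w2 K C c t / 2)) (K * (C * Real.exp (-c * t) * w2 K C c t)) t := by
  have h1 : HasDerivAt (fun t : ℝ => Real.exp (-c * t)) (Real.exp (-c * t) * (-c * 1)) t :=
    ((hasDerivAt_id t).const_mul (-c)).exp
  have h2 := (((h1.const_mul (2 * K * C / c)).exp).div_const 2).neg
  refine h2.congr_deriv ?_
  unfold w2
  field_simp

lemma w2_tendsto (hc : 0 < c) : Tendsto (w2 K C c) atTop (𝓝 1) := by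
  have h1 : Tendsto (fun t : ℝ => -c * t) atTop atBot :=
    tendsto_id.const_mul_atTop_of_neg (by linarith)
  have h2 := (Real.tendsto_exp_atBot.comp h1).const_mul (2 * K * C / c)
  rw [mul_zero] at h2
  have h3 := (Real.continuous_exp.tendsto 0).comp h2
  rw [Real.exp_zero] at h3
  exact h3

lemma w2_int (bd : BwdData M K C c w) (t : ℝ) :
    IntegrableOn (fun s => K * (C * Real.exp (-c * s) * w2 K C c s)) (Ioi t) ∧
    ∫ s in Ioi t, K * (C * Real.exp (-c * s) * w2 K C c s) = (w2 K C c t - 1) / 2 := by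
  have hK := bd.hK; have hC := bd.hC
  have hd : ∀ s ∈ Ici t, HasDerivAt (fun t => -(w2 K C c t / 2))
    (K * (C * Real.exp (-c * s) * w2 K C c s)) s := fun s _ => w2_hasDerivAt bd.hc.ne' s
  have hl : Tendsto (fun t => -(w2 K C c t / 2)) atTop (𝓝 (-(1 / 2))) :=
    ((w2_tendsto bd.hc).div_const 2).neg
  have hp : ∀ s ∈ Ioi t, 0 ≤ K * (C * Real.exp (-c * s) * w2 K C c s) := fun s _ => by
    have := w2_pos K C c s
    positivity
  refine ⟨integrableOn_Ioi_deriv_of_nonneg' hd hp hl, ?_⟩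
  rw [integral_Ioi_of_hasDerivAt_of_nonneg' hd hp hl]
  ring

lemma bwd_integrable (bd : BwdData M K C c w) {F : ℝ → E} (hF : Continuous F) {G : ℝ}
    (hFG : ∀ s, 0 ≤ s → ‖F s‖ ≤ C * Real.exp (-c * s) * w2 K C c s * G) {t : ℝ} (ht : 0 ≤ t) :
    IntegrableOn (fun s => ex M s (F s)) (Ioi t) := by
  refine Integrable.mono' ((w2_int bd t).1.mul_const G)
    (ex_app_continuous M hF).aestronglyMeasurable ?_
  refine (ae_restrict_iff' measurableSet_Ioi).2 (Eventually.of_forall fun s hs => ?_)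
  have hs0 : 0 ≤ s := ht.trans (le_of_lt hs)
  refine (ContinuousLinearMap.le_opNorm _ _).trans ?_
  refine (mul_le_mul (bd.hM s hs0) (hFG s hs0) (norm_nonneg _) bd.hK.le).trans_eq ?_
  ring

lemma bwd_eq (bd : BwdData M K C c w) {F : ℝ → E} (hF : Continuous F) {G : ℝ}
    (hFG : ∀ s, 0 ≤ s → ‖F s‖ ≤ C * Real.exp (-c * s) * w2 K C c s * G) {t : ℝ} (ht : 0 ≤ t) :
    bwd M F t = ∫ s in Ioi t, ex M (s - t) (F s) := by
  have hi := bwd_integrable bd hF hFG ht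
  have hi0 := bwd_integrable bd hF hFG le_rfl
  unfold bwd
  rw [← intervalIntegral.integral_interval_add_Ioi hi0 hi, add_sub_cancel_left,
    ← ContinuousLinearMap.integral_comp_comm _ hi]
  simp only [ex_add_apply]
  congr 1; funext s; rw [sub_eq_neg_add]

lemma bwd_bound (bd : BwdData M K C c w) {F : ℝ → E} (hF : Continuous F) {G : ℝ}
    (hFG : ∀ s, 0 ≤ s → ‖F s‖ ≤ C * Real.exp (-c * s) * w2 K C c s * G) {t : ℝ} (ht : 0 ≤ t) :
    ‖bwd M F t‖ ≤ (w2 K C c t - 1) / 2 * G := by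
  rw [bwd_eq bd hF hFG ht, ← (w2_int bd t).2, ← integral_mul_const]
  refine norm_integral_le_of_norm_le ((w2_int bd t).1.mul_const G) ?_
  refine (ae_restrict_iff' measurableSet_Ioi).2 (Eventually.of_forall fun s hs => ?_)
  have hs' : t < s := hs
  have hs0 : 0 ≤ s := ht.trans (le_of_lt hs)
  refine (ContinuousLinearMap.le_opNorm _ _).trans ?_
  refine (mul_le_mul (bd.hM (s - t) (by linarith)) (hFG s hs0)
    (norm_nonneg _) bd.hK.le).trans_eq ?_
  ring

lemma bwd_tendsto (bd : BwdData M K C c w) {F : ℝ → E} (hF : Continuous F) {G : ℝ}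
    (hFG : ∀ s, 0 ≤ s → ‖F s‖ ≤ C * Real.exp (-c * s) * w2 K C c s * G) :
    Tendsto (bwd M F) atTop (𝓝 0) := by
  have h1 : Tendsto (fun t => (w2 K C c t - 1) / 2 * G) atTop (𝓝 ((1 - 1) / 2 * G)) :=
    (((w2_tendsto bd.hc).sub_const 1).div_const 2).mul_const G
  have h0 : ((1 : ℝ) - 1) / 2 * G = 0 := by ring
  rw [h0] at h1
  refine squeeze_zero_norm' ?_ h1
  filter_upwards [eventually_ge_atTop 0] with t ht
  exact bwd_bound bd hF hFG ht

lemma bwd_add (bd : BwdData M K C c w) {F F' : ℝ → E} (hF : Continuous F) (hF' : Continuous F')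
    {G G' : ℝ} (hFG : ∀ s, 0 ≤ s → ‖F s‖ ≤ C * Real.exp (-c * s) * w2 K C c s * G)
    (hFG' : ∀ s, 0 ≤ s → ‖F' s‖ ≤ C * Real.exp (-c * s) * w2 K C c s * G') (t : ℝ) :
    bwd M (fun s => F s + F' s) t = bwd M F t + bwd M F' t := by
  unfold bwd
  rw [← map_add]
  simp only [map_add]
  rw [integral_add (bwd_integrable bd hF hFG le_rfl) (bwd_integrable bd hF' hFG' le_rfl),
    intervalIntegral.integral_add ((ex_app_continuous M hF).intervalIntegrable _ _)
      ((ex_app_continuous M hF').intervalIntegrable _ _)]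
  simp only [map_add, map_sub]
  abel

lemma bwd_smul {F : ℝ → E} (a t : ℝ) :
    bwd M (fun s => a • F s) t = a • bwd M F t := by
  unfold bwd
  rw [← map_smul, smul_sub, ← integral_smul, ← intervalIntegral.integral_smul]
  simp

lemma bwd_congr {F F' : ℝ → E} {t : ℝ} (ht : 0 ≤ t)
    (h : ∀ s, 0 ≤ s → F s = F' s) : bwd M F t = bwd M F' t := by
  unfold bwd
  congr 2
  · refine setIntegral_congr_fun measurableSet_Ioi fun s hs => ?_
    simp only [h s (le_of_lt hs)]
  · refine intervalIntegral.integral_congr fun s hs => ?_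
    rw [uIcc_of_le ht] at hs
    simp only [h s hs.1]

/-- Integrand of the backward operator. -/
noncomputable def rint (K C c : ℝ) (w : ℝ → ℝ) (g : ℝ → E) (s : ℝ) : E := w2 K C c s • w s • g s

lemma rint_cont (bd : BwdData M K C c w) {g : ℝ → E} (hg : Continuous g) :
    Continuous (rint K C c w g) := (w2_continuous K C c).smul (bd.hwc.smul hg)

lemma rint_bd' (g : ℝ → E) {G : ℝ}
    (hgG : ∀ s, 0 ≤ s → ‖w s • g s‖ ≤ C * Real.exp (-c * s) * G) (s : ℝ) (hs : 0 ≤ s) :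
    ‖rint K C c w g s‖ ≤ C * Real.exp (-c * s) * w2 K C c s * G := by
  unfold rint
  rw [norm_smul, Real.norm_of_nonneg (w2_pos _ _ _ _).le]
  refine (mul_le_mul_of_nonneg_left (hgG s hs) (w2_pos _ _ _ _).le).trans_eq ?_
  ring

lemma rint_pre (bd : BwdData M K C c w) (g : ℝ →ᵇ E) (s : ℝ) (hs : 0 ≤ s) :
    ‖w s • g s‖ ≤ C * Real.exp (-c * s) * (‖g‖ / C) := by
  have hC := bd.hC
  rw [norm_smul]
  refine (mul_le_mul (bd.hw s hs) (g.norm_coe_le_norm s) (norm_nonneg _)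
    (Real.exp_pos _).le).trans_eq ?_
  field_simp

lemma rint_bd (bd : BwdData M K C c w) (g : ℝ →ᵇ E) (s : ℝ) (hs : 0 ≤ s) :
    ‖rint K C c w g s‖ ≤ C * Real.exp (-c * s) * w2 K C c s * (‖g‖ / C) :=
  rint_bd' g (rint_pre bd g) s hs

lemma R_cont (bd : BwdData M K C c w) {g : ℝ → E} (hg : Continuous g) :
    Continuous (fun t : ℝ => (w2 K C c (max t 0))⁻¹ • bwd M (rint K C c w g) (max t 0)) := by
  have hm : Continuous fun t : ℝ => max t 0 := continuous_id.max continuous_const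
  refine (((w2_continuous K C c).comp hm).inv₀ fun t => (w2_pos _ _ _ _).ne').smul ?_
  exact (bwd_continuous M (rint_cont bd hg)).comp hm

lemma R_bd (bd : BwdData M K C c w) {g : ℝ → E} (hg : Continuous g) {G : ℝ} (hG : 0 ≤ G)
    (hgG : ∀ s, 0 ≤ s → ‖w s • g s‖ ≤ C * Real.exp (-c * s) * G) (t : ℝ) :
    ‖(w2 K C c (max t 0))⁻¹ • bwd M (rint K C c w g) (max t 0)‖ ≤ G / 2 := by
  have hp := w2_pos K C c (max t 0)
  rw [norm_smul, norm_inv, Real.norm_of_nonneg hp.le, inv_mul_le_iff₀ hp]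
  refine (bwd_bound bd (rint_cont bd hg) (rint_bd' g hgG) (le_max_right _ _)).trans ?_
  nlinarith

/-- The weighted backward operator. -/
noncomputable def R (bd : BwdData M K C c w) : (ℝ →ᵇ E) →L[ℝ] (ℝ →ᵇ E) :=
  have key : ∀ (g : ℝ →ᵇ E) (t : ℝ),
      ‖(w2 K C c (max t 0))⁻¹ • bwd M (rint K C c w g) (max t 0)‖ ≤ (2 * C)⁻¹ * ‖g‖ := fun g t => by
    have hC := bd.hC
    refine (R_bd bd g.continuous (G := ‖g‖ / C) (by positivity) (rint_pre bd g) t).trans ?_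
    apply le_of_eq; field_simp
  LinearMap.mkContinuous
    { toFun := fun g => BoundedContinuousFunction.ofNormedAddCommGroup _
        (R_cont bd g.continuous) ((2 * C)⁻¹ * ‖g‖) (key g)
      map_add' := fun g h => by
        ext t
        have := bwd_add bd (rint_cont bd g.continuous) (rint_cont bd h.continuous)
          (rint_bd bd g) (rint_bd bd h) (max t 0)
        have e1 : rint K C c w (⇑(g + h)) = fun s => rint K C c w g s + rint K C c w h s := by
          funext s; simp [rint, smul_add]
        simp only [BoundedContinuousFunction.coe_ofNormedAddCommGroup,
          BoundedContinuousFunction.add_apply]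
        rw [e1, this, smul_add]
      map_smul' := fun a g => by
        ext t
        have := bwd_smul (M := M) (F := rint K C c w g) a (max t 0)
        have e1 : rint K C c w (⇑(a • g)) = fun s => a • rint K C c w g s := by
          funext s; simp only [rint, BoundedContinuousFunction.coe_smul]
          rw [smul_comm (w s) a, smul_comm _ a]
        simp only [BoundedContinuousFunction.coe_ofNormedAddCommGroup, RingHom.id_apply]
        rw [e1, this]
        simp only [BoundedContinuousFunction.coe_ofNormedAddCommGroup, RingHom.id_apply,
          BoundedContinuousFunction.coe_smul]
        rw [smul_comm] }
    (2 * C)⁻¹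
    (fun g => BoundedContinuousFunction.norm_ofNormedAddCommGroup_le _
      (by have := bd.hC; positivity) (key g))

lemma R_apply (bd : BwdData M K C c w) (g : ℝ →ᵇ E) (t : ℝ) :
    R bd g t = (w2 K C c (max t 0))⁻¹ • bwd M (rint K C c w g) (max t 0) := rfl

lemma R_norm_le (bd : BwdData M K C c w) (g : ℝ →ᵇ E) {G : ℝ} (hG : 0 ≤ G)
    (hgG : ∀ s, 0 ≤ s → ‖w s • g s‖ ≤ C * Real.exp (-c * s) * G) : ‖R bd g‖ ≤ G / 2 :=
  (BoundedContinuousFunction.norm_le (by positivity)).2 fun t => R_bd bd g.continuous hG hgG t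

end Backward

end DensReg


namespace DensReg

open Set Filter Topology BoundedContinuousFunction MeasureTheory
open scoped NNReal


set_option linter.unusedSectionVars false
set_option linter.unusedSimpArgs false

section Duhamel

variable {E : Type*} [NormedAddCommGroup E] [NormedSpace ℝ E] [CompleteSpace E]

lemma lin_unique (M : E →L[ℝ] E) {d : ℝ → E}
    (hd : ∀ t, 0 ≤ t → HasDerivWithinAt d (-(M (d t))) (Ici 0) t) {t : ℝ} (ht : 0 ≤ t) :
    ex M t (d t) = d 0 := by
  have h1 : ∀ t, 0 ≤ t → HasDerivWithinAt (fun t => ex M t (d t)) 0 (Ici 0) t := by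
    intro t ht
    have := (ex_hasDerivAt' M t).hasDerivWithinAt.clm_apply (hd t ht)
    convert! this using 1
    simp only [mul_apply_eq_comp, map_neg, add_neg_cancel]
  have := constant_of_has_deriv_right_zero (f := fun t => ex M t (d t)) (a := 0) (b := t)
    (fun s hs => ((h1 s hs.1).continuousWithinAt).mono Icc_subset_Ici_self)
    (fun s hs => (h1 s hs.1).mono (Ici_subset_Ici.2 hs.1)) t ⟨ht, le_rfl⟩
  simpa [ex_zero] using this

lemma ex_neg_left (J : E →L[ℝ] E) (t : ℝ) : ex (-J) t = ex J (-t) := by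
  simp [ex]

lemma duhamel_fwd (J : E →L[ℝ] E) {x F : ℝ → E} (hF : Continuous F)
    (hx : ∀ t, 0 ≤ t → HasDerivWithinAt x (J (x t) + F t) (Ici 0) t) {t : ℝ} (ht : 0 ≤ t) :
    x t = ex J t (x 0) + fwd J F t := by
  have := lin_unique (-J) (d := fun t => x t - fwd J F t) (fun s hs => by
    refine ((hx s hs).sub (fwd_hasDerivAt J hF s).hasDerivWithinAt).congr_deriv ?_
    simp) ht
  rw [ex_neg_left, fwd_zero, sub_zero] at this
  rw [← this, ex_neg_apply, sub_add_cancel]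

lemma duhamel_bwd {M : E →L[ℝ] E} {K C c : ℝ} {w : ℝ → ℝ} (bd : BwdData M K C c w)
    {d F : ℝ → E} (hF : Continuous F) {G : ℝ}
    (hFG : ∀ s, 0 ≤ s → ‖F s‖ ≤ C * Real.exp (-c * s) * w2 K C c s * G)
    (hd : ∀ t, 0 ≤ t → HasDerivWithinAt d (-(M (d t)) - F t) (Ici 0) t)
    (hl : Tendsto d atTop (𝓝 0)) {t : ℝ} (ht : 0 ≤ t) : d t = bwd M F t := by
  have key : ∀ t, 0 ≤ t → ex M t (d t - bwd M F t) = d 0 - bwd M F 0 := fun t ht =>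
    lin_unique M (d := fun t => d t - bwd M F t) (fun s hs => by
      refine ((hd s hs).sub (bwd_hasDerivAt M hF s).hasDerivWithinAt).congr_deriv ?_
      simp only [map_sub]; abel) ht
  have hl2 : Tendsto (fun t => K * ‖d t - bwd M F t‖) atTop (𝓝 0) := by
    have := ((hl.sub (bwd_tendsto bd hF hFG)).norm).const_mul K
    simpa using this
  have h0 : d 0 - bwd M F 0 = 0 := by
    have : Tendsto (fun _ : ℝ => d 0 - bwd M F 0) atTop (𝓝 0) := by
      refine squeeze_zero_norm' ?_ hl2
      filter_upwards [eventually_ge_atTop 0] with t ht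
      rw [← key t ht]
      exact (ContinuousLinearMap.le_opNorm _ _).trans
        (mul_le_mul_of_nonneg_right (bd.hM t ht) (norm_nonneg _))
    exact tendsto_nhds_unique tendsto_const_nhds this
  have h1 := key t ht
  rw [h0] at h1
  have h2 := ex_neg_apply' M t (d t - bwd M F t)
  rw [h1, map_zero] at h2
  exact sub_eq_zero.1 h2.symm

lemma exp_conv {J : E →L[ℝ] E} {K c b D : ℝ} (hd : FwdData J K c b D) {z F : ℝ → E}
    (hz : Continuous z) (hF : Continuous F)
    (hx : ∀ t, 0 ≤ t → HasDerivWithinAt z (J (z t) + F t) (Ici 0) t)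
    (hFz : ∀ t, 0 ≤ t → ‖F t‖ ≤ (b + D * Real.exp (-t)) * ‖z t‖) {T : ℝ} (hT : 0 ≤ T) :
    ‖z T‖ ≤ 2 * (K * Real.exp (2 * K * D) * ‖z 0‖) * wt K c b D T := by
  have hwc := wt_continuous K c b D
  obtain ⟨m, hm, hmax⟩ := isCompact_Icc.exists_isMaxOn (nonempty_Icc.2 hT)
    (f := fun t => (wt K c b D t)⁻¹ * ‖z t‖)
    ((hwc.inv₀ fun t => (wt_pos _ _ _ _ _).ne').mul hz.norm).continuousOn
  set G := (wt K c b D m)⁻¹ * ‖z m‖ with hG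
  have hwp := fun t => wt_pos K c b D t
  have hle : ∀ s, 0 ≤ s → s ≤ T → ‖z s‖ ≤ wt K c b D s * G := fun s h1 h2 => by
    have : (wt K c b D s)⁻¹ * ‖z s‖ ≤ G := hmax ⟨h1, h2⟩
    rwa [inv_mul_le_iff₀ (hwp s)] at this
  have hG0 : 0 ≤ G := mul_nonneg (inv_nonneg.2 (hwp m).le) (norm_nonneg _)
  have h1 : ‖fwd J F m‖ ≤ wt K c b D m * (G / 2) := by
    refine fwd_wt_bound J hF hd.hJ hm.1 hG0 fun s hs hsm => ?_
    have h2 := hle s hs (hsm.trans hm.2)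
    have h3 : 0 ≤ b + D * Real.exp (-s) := by
      have := hd.hb; have := hd.hD; positivity
    refine (hFz s hs).trans ((mul_le_mul_of_nonneg_left h2 h3).trans_eq (by ring))
  have h2 := iota_bd hd (z 0) m
  rw [max_eq_left hm.1, norm_smul, norm_inv, Real.norm_of_nonneg (hwp m).le,
    inv_mul_le_iff₀ (hwp m)] at h2
  have h3 : ‖z m‖ ≤ wt K c b D m * (K * Real.exp (2 * K * D) * ‖z 0‖ + G / 2) := by
    rw [duhamel_fwd J hF hx hm.1]
    refine (norm_add_le _ _).trans ?_
    linarith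
  have h4 : G ≤ K * Real.exp (2 * K * D) * ‖z 0‖ + G / 2 := by
    rw [hG, inv_mul_le_iff₀ (hwp m)]; exact h3
  have h5 := hle T hT le_rfl
  have h6 := hwp T
  nlinarith

end Duhamel

section Setup

variable {E : Type*} [NormedAddCommGroup E] [NormedSpace ℝ E] [CompleteSpace E]

/-- Assumptions on the (cut off) vector field and linear part. -/
structure Sys (θ : E → E) (M : E → E →L[ℝ] E) (e v : E) (K c K2 : ℝ) : Prop where
  hθ : ContDiff ℝ 2 θ
  hθs : HasCompactSupport θ
  hM : ContDiff ℝ 2 M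
  hMs : HasCompactSupport M
  hθe : θ e = 0
  hMv : M e v = 0
  hK : 0 < K
  hc : 0 < c
  hJ : ∀ r, 0 ≤ r → ‖ex (fderiv ℝ θ e) r‖ ≤ K * Real.exp (-c * r)
  hK2 : 0 < K2
  hM2 : ∀ r, 0 ≤ r → ‖ex (M e) r‖ ≤ K2

variable {θ : E → E} {M : E → E →L[ℝ] E} {e v : E} {K c K2 : ℝ}

/-- `x` solves the ODE on the half line and converges to `e`. -/
structure SolX (θ : E → E) (e : E) (x : ℝ → E) : Prop where
  ode : ∀ t, 0 ≤ t → HasDerivWithinAt x (θ (x t)) (Ici 0) t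
  lim : Tendsto x atTop (𝓝 e)

/-- `y` solves the linear ODE along `x` and converges to `v`. -/
structure SolY (M : E → E →L[ℝ] E) (v : E) (x y : ℝ → E) : Prop where
  ode : ∀ t, 0 ≤ t → HasDerivWithinAt y (-(M (x t) (y t))) (Ici 0) t
  lim : Tendsto y atTop (𝓝 v)

lemma clamp_continuous {x : ℝ → E} (h : ContinuousOn x (Ici 0)) :
    Continuous fun t => x (max t 0) := by
  rw [← continuousOn_univ]
  exact h.comp (continuous_id.max continuous_const).continuousOn (fun t _ => mem_Ici.2 (le_max_right _ _))

lemma SolX.cont {x : ℝ → E} (h : SolX θ e x) : ContinuousOn x (Ici 0) := fun t ht =>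
  (h.ode t ht).continuousWithinAt

lemma SolY.cont {x y : ℝ → E} (h : SolY M v x y) : ContinuousOn y (Ici 0) := fun t ht =>
  (h.ode t ht).continuousWithinAt

lemma exists_fwdData (S : Sys θ M e v K c K2) {x : ℝ → E} (hx : SolX θ e x) :
    ∃ b D, FwdData (fderiv ℝ θ e) K c b D ∧
      (∀ t, 0 ≤ t → ‖fderiv ℝ θ (x t) - fderiv ℝ θ e‖ ≤ b + D * Real.exp (-t)) ∧
      (∀ t, 0 ≤ t → ‖θ (x t) - fderiv ℝ θ e (x t - e)‖ ≤ (b + D * Real.exp (-t)) * ‖x t - e‖) := by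
  have hK := S.hK; have hc := S.hc
  have hC1 : ContDiff ℝ 1 θ := S.hθ.of_le one_le_two
  obtain ⟨L, hL⟩ := hC1.lipschitzWith_of_hasCompactSupport S.hθs one_ne_zero
  have hLd : ∀ y, ‖fderiv ℝ θ y‖ ≤ L := fun y => norm_fderiv_le_of_lipschitz ℝ hL
  have hcd := hC1.continuous_fderiv one_ne_zero
  set b := c / (4 * K) with hb
  have hbp : 0 < b := by positivity
  obtain ⟨δ, hδ, hball⟩ := Metric.continuous_iff.1 hcd e b hbp
  obtain ⟨T, hT⟩ := eventually_atTop.1 (Metric.tendsto_nhds.1 hx.lim δ hδ)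
  set D := 2 * (L : ℝ) * Real.exp (max T 0) with hD
  have hD0 : 0 ≤ D := by positivity
  have hDe : ∀ t, t < T → 2 * (L : ℝ) ≤ D * Real.exp (-t) := fun t ht => by
    rw [hD, mul_assoc, ← Real.exp_add]
    have : 1 ≤ Real.exp (max T 0 + -t) := Real.one_le_exp (by
      have := le_max_left T 0; linarith)
    nlinarith [L.2]
  have hDp : ∀ t, 0 ≤ D * Real.exp (-t) := fun t => by positivity
  refine ⟨b, D, ⟨S.hJ, hK, hbp, hD0, ?_⟩, fun t ht => ?_, fun t ht => ?_⟩
  · rw [hb]; field_simp; linarith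
  · rcases lt_or_ge t T with h | h
    · have := norm_sub_le (fderiv ℝ θ (x t)) (fderiv ℝ θ e)
      linarith [hLd (x t), hLd e, hDe t h]
    · have := hball (x t) (hT t h)
      rw [dist_eq_norm] at this
      linarith [hDp t]
  · rcases lt_or_ge t T with h | h
    · have h1 := hL.dist_le_mul (x t) e
      rw [dist_eq_norm, dist_eq_norm, S.hθe, sub_zero] at h1
      have h2 := (fderiv ℝ θ e).le_of_opNorm_le (hLd e) (x t - e)
      have h3 := norm_sub_le (θ (x t)) (fderiv ℝ θ e (x t - e))
      have h4 := mul_le_mul_of_nonneg_right (hDe t h) (norm_nonneg (x t - e))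
      have h5 := norm_nonneg (x t - e)
      nlinarith
    · have key := Convex.norm_image_sub_le_of_norm_fderiv_le' (𝕜 := ℝ) (f := θ)
        (s := Metric.ball e δ) (φ := fderiv ℝ θ e) (C := b) (x := e) (y := x t)
        (fun y _ => (hC1.differentiable one_ne_zero) y)
        (fun y hy => by rw [← dist_eq_norm]; exact (hball y hy).le)
        (convex_ball _ _) (Metric.mem_ball_self hδ) (hT t h)
      rw [S.hθe, sub_zero] at key
      have h5 := mul_nonneg (hDp t) (norm_nonneg (x t - e))
      linarith

lemma clamp_deriv {x : ℝ → E} {x' : E} {t : ℝ} (ht : 0 ≤ t) (h : HasDerivWithinAt x x' (Ici 0) t) :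
    HasDerivWithinAt (fun s => x (max s 0)) x' (Ici 0) t :=
  h.congr (fun s hs => by rw [max_eq_left hs]) (by rw [max_eq_left ht])

lemma SolX.decay (S : Sys θ M e v K c K2) {x : ℝ → E} (hx : SolX θ e x) {b D : ℝ}
    (hd : FwdData (fderiv ℝ θ e) K c b D)
    (hF : ∀ t, 0 ≤ t →
      ‖θ (x t) - fderiv ℝ θ e (x t - e)‖ ≤ (b + D * Real.exp (-t)) * ‖x t - e‖) :
    ∃ C1, 0 ≤ C1 ∧ ∀ t, 0 ≤ t → ‖x t - e‖ ≤ C1 * wt K c b D t := by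
  have hxc := clamp_continuous hx.cont
  refine ⟨2 * (K * Real.exp (2 * K * D) * ‖x 0 - e‖), by have := hd.hK; positivity,
    fun t ht => ?_⟩
  have := exp_conv hd (z := fun t => x (max t 0) - e)
    (F := fun t => θ (x (max t 0)) - fderiv ℝ θ e (x (max t 0) - e))
    (hxc.sub continuous_const)
    ((S.hθ.continuous.comp hxc).sub ((fderiv ℝ θ e).continuous.comp (hxc.sub continuous_const)))
    (fun t ht => by
      refine ((clamp_deriv ht (hx.ode t ht)).sub_const e).congr_deriv ?_
      rw [max_eq_left ht]; abel)
    (fun t ht => by rw [max_eq_left ht]; exact hF t ht) ht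
  simpa [max_eq_left ht] using this

/-- Uniqueness of the backward problem. -/
lemma SolY.unique (S : Sys θ M e v K c K2) {x y1 y2 : ℝ → E} (hx : SolX θ e x)
    (h1 : SolY M v x y1) (h2 : SolY M v x y2) {t : ℝ} (ht : 0 ≤ t) : y1 t = y2 t := by
  obtain ⟨b, D, hd, -, hF⟩ := exists_fwdData S hx
  obtain ⟨C1, hC1, hdec⟩ := hx.decay S hd hF
  have hMC1 : ContDiff ℝ 1 M := S.hM.of_le one_le_two
  obtain ⟨L, hL⟩ := hMC1.lipschitzWith_of_hasCompactSupport S.hMs one_ne_zero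
  set C := L * C1 + 1 with hC
  have hCp : 0 < C := by positivity
  have bd : BwdData (M e) K2 C (c - 2 * K * b) (fun _ => 0) :=
    ⟨S.hM2, S.hK2, hCp, by linarith [hd.hc], continuous_const, fun s _ => by simp; positivity⟩
  have hMx : ∀ s, 0 ≤ s → ‖M (x s) - M e‖ ≤ C * Real.exp (-(c - 2 * K * b) * s) := fun s hs => by
    have h3 := hL.dist_le_mul (x s) e
    rw [dist_eq_norm, dist_eq_norm] at h3
    have h4 := hdec s hs
    have h5 := wt_le_exp hd s
    have h6 : (L : ℝ) * ‖x s - e‖ ≤ L * (C1 * Real.exp (-(c - 2 * K * b) * s)) :=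
      mul_le_mul_of_nonneg_left (h4.trans (mul_le_mul_of_nonneg_left h5 hC1)) L.2
    have h7 := Real.exp_pos (-(c - 2 * K * b) * s)
    rw [hC]; nlinarith
  set d := fun t => y1 (max t 0) - y2 (max t 0) with hdd
  have hxc := clamp_continuous hx.cont
  have hdc : Continuous d := (clamp_continuous h1.cont).sub (clamp_continuous h2.cont)
  set F := fun t => (M (x (max t 0)) - M e) (d t) with hFF
  have hFc : Continuous F := ((S.hM.continuous.comp hxc).sub continuous_const).clm_apply hdc
  have hlim : Tendsto d atTop (𝓝 0) := by
    have := h1.lim.sub h2.lim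
    rw [sub_self] at this
    refine this.congr' ?_
    filter_upwards [eventually_ge_atTop 0] with t ht
    simp [d, max_eq_left ht]
  have hode : ∀ t, 0 ≤ t → HasDerivWithinAt d (-(M e (d t)) - F t) (Ici 0) t := fun t ht => by
    refine ((clamp_deriv ht (h1.ode t ht)).sub (clamp_deriv ht (h2.ode t ht))).congr_deriv ?_
    simp only [F, d, max_eq_left ht, map_sub, _root_.sub_apply]
    abel
  have step : ∀ G, (∀ s, 0 ≤ s → ‖d s‖ ≤ w2 K2 C (c - 2 * K * b) s * G) →
      ∀ s, 0 ≤ s → ‖d s‖ ≤ w2 K2 C (c - 2 * K * b) s * (G / 2) := by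
    intro G hG s hs
    have hG0 : 0 ≤ G := by
      have h3 := (norm_nonneg _).trans (hG 0 le_rfl)
      exact nonneg_of_mul_nonneg_right h3 (w2_pos _ _ _ _)
    have hFG : ∀ s, 0 ≤ s → ‖F s‖ ≤ C * Real.exp (-(c - 2 * K * b) * s) *
        w2 K2 C (c - 2 * K * b) s * G := fun s hs => by
      refine (ContinuousLinearMap.le_opNorm _ _).trans ?_
      rw [max_eq_left hs]
      refine (mul_le_mul (hMx s hs) (hG s hs) (norm_nonneg _) (by positivity)).trans_eq ?_
      ring
    rw [duhamel_bwd bd hFc hFG hode hlim hs]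
    refine (bwd_bound bd hFc hFG hs).trans ?_
    nlinarith
  have hbdd : ∃ G, ∀ s, 0 ≤ s → ‖d s‖ ≤ w2 K2 C (c - 2 * K * b) s * G := by
    obtain ⟨T, hT⟩ := eventually_atTop.1 (Metric.tendsto_nhds.1 hlim 1 one_pos)
    obtain ⟨G0, hG0⟩ := (isCompact_Icc (a := (0 : ℝ)) (b := T)).exists_bound_of_continuousOn
      hdc.continuousOn
    refine ⟨max G0 1, fun s hs => ?_⟩
    have h3 : ‖d s‖ ≤ max G0 1 := by
      rcases lt_or_ge s T with h | h
      · exact (hG0 s ⟨hs, h.le⟩).trans (le_max_left _ _)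
      · have := hT s h
        rw [dist_zero_right] at this
        exact this.le.trans (le_max_right _ _)
    have h4 := w2_one_le bd s
    have h5 : 1 ≤ max G0 1 := le_max_right _ _
    nlinarith
  obtain ⟨G, hG⟩ := hbdd
  have hn : ∀ n : ℕ, ∀ s, 0 ≤ s → ‖d s‖ ≤ w2 K2 C (c - 2 * K * b) s * (G * (1 / 2) ^ n) := by
    intro n
    induction n with
    | zero => simpa using hG
    | succ n ih =>
      intro s hs
      refine (step _ ih s hs).trans_eq ?_
      rw [pow_succ]; ring
  have hlim0 : Tendsto (fun n : ℕ => w2 K2 C (c - 2 * K * b) t * (G * (1 / 2) ^ n)) atTop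
      (𝓝 0) := by
    have := ((tendsto_pow_atTop_nhds_zero_of_lt_one (r := (1 / 2 : ℝ)) (by norm_num)
      (by norm_num)).const_mul G).const_mul (w2 K2 C (c - 2 * K * b) t)
    simpa using this
  have h0 : ‖d t‖ ≤ 0 := ge_of_tendsto' hlim0 fun n => hn n t ht
  have h3 : d t = 0 := norm_le_zero_iff.1 h0
  simpa [d, max_eq_left ht, sub_eq_zero] using h3

end Setup

end DensReg


namespace DensReg

open Set Filter Topology BoundedContinuousFunction MeasureTheory
open scoped NNReal


set_option linter.unusedSectionVars false
set_option linter.unusedSimpArgs false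

section LocalThm

variable {E : Type*} [NormedAddCommGroup E] [NormedSpace ℝ E] [CompleteSpace E]
variable {θ : E → E} {M : E → E →L[ℝ] E} {e v : E} {K c K2 : ℝ}

/-- Inversion of a perturbation of the identity. -/
lemma exists_equiv_one_sub {X : Type*} [NormedAddCommGroup X] [NormedSpace ℝ X] [CompleteSpace X]
    (T : X →L[ℝ] X) (hT : ‖T‖ ≤ 1 / 2) : IsUnit (1 - T) :=
  (Units.oneSub T (lt_of_le_of_lt hT (by norm_num))).isUnit

/-- Forward part: the solution depends smoothly on initial data, in the weighted space. -/
lemma local_fwd (S : Sys θ M e v K c K2) {x : ℝ → E} (hx : SolX θ e x) {b D : ℝ}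
    {J : E →L[ℝ] E} (hd : FwdData J K c b D)
    (hD1 : ∀ t, 0 ≤ t → ‖fderiv ℝ θ (x t) - J‖ ≤ b + D * Real.exp (-t))
    {ub : ℝ →ᵇ E} (hub : ∀ t, aff e (wtB hd) ub t = x (max t 0)) :
    ∃ Uf : E → (ℝ →ᵇ E), ContDiffAt ℝ 2 Uf (x 0) ∧ Uf (x 0) = ub ∧
      ∀ᶠ h in 𝓝 (x 0), aff e (wtB hd) (Uf h) 0 = h ∧ SolX θ e (aff e (wtB hd) (Uf h)) := by
  have hC1 : ContDiff ℝ 1 θ := S.hθ.of_le one_le_two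
  obtain ⟨L, hL⟩ := hC1.lipschitzWith_of_hasCompactSupport S.hθs one_ne_zero
  have hwp : ∀ t, 0 < wtB hd t := fun t => wt_pos _ _ _ _ _
  set Jc : ℝ →ᵇ (E →L[ℝ] E) := BoundedContinuousFunction.const ℝ J with hJc
  set N := wsup θ L hL e (wtB hd) hwp with hN
  set Ψ : (ℝ →ᵇ E) → (ℝ →ᵇ E) := fun u => u - V hd (N u - mult ℝ E E Jc u) with hΨ
  have hNC : ContDiff ℝ 2 N := wsup_contDiff θ L hL e _ hwp S.hθ S.hθs
  have hΨC : ContDiff ℝ 2 Ψ :=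
    contDiff_id.sub ((V hd).contDiff.comp (hNC.sub (mult ℝ E E Jc).contDiff))
  set DN := mult ℝ E E (sup0 (toB (fderiv ℝ θ) (hC1.continuous_fderiv one_ne_zero)
    (S.hθs.fderiv ℝ)) (aff e (wtB hd) ub)) with hDN
  set T : (ℝ →ᵇ E) →L[ℝ] (ℝ →ᵇ E) := (V hd).comp (DN - mult ℝ E E Jc) with hT
  have hT2 : ‖T‖ ≤ 1 / 2 := by
    refine ContinuousLinearMap.opNorm_le_bound _ (by norm_num) fun k => ?_
    have := V_norm_le hd ((DN - mult ℝ E E Jc) k) (G := ‖k‖) (norm_nonneg _) (fun s hs => by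
      have e1 : ((DN - mult ℝ E E Jc) k) s = (fderiv ℝ θ (x s) - J) (k s) := by
        change DN k s - mult ℝ E E Jc k s = _
        simp only [DN, _root_.sub_apply, mult_apply, sup0_apply, toB_apply, hub, max_eq_left hs,
          Jc, BoundedContinuousFunction.const_apply]
      rw [e1]
      exact (ContinuousLinearMap.le_opNorm _ _).trans
        (mul_le_mul (hD1 s hs) (k.norm_coe_le_norm s) (norm_nonneg _)
          ((norm_nonneg _).trans (hD1 s hs))))
    refine this.trans_eq (by ring)
  have hΨd : HasFDerivAt Ψ (1 - T) ub :=
    (hasFDerivAt_id ub).sub ((V hd).hasFDerivAt.comp ub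
      ((wsup_hasFDerivAt θ L hL e _ hwp hC1 S.hθs ub).sub (mult ℝ E E Jc).hasFDerivAt))
  obtain ⟨un, hun⟩ := exists_equiv_one_sub T hT2
  set eqv := ContinuousLinearEquiv.unitsEquiv ℝ (ℝ →ᵇ E) un with heqv
  have hcoe : ((eqv : (ℝ →ᵇ E) ≃L[ℝ] (ℝ →ᵇ E)) : (ℝ →ᵇ E) →L[ℝ] (ℝ →ᵇ E)) = 1 - T := by
    rw [← hun]; ext; rfl
  have hΨd' : HasFDerivAt Ψ (eqv : (ℝ →ᵇ E) →L[ℝ] (ℝ →ᵇ E)) ub := by rw [hcoe]; exact hΨd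
  have h2 : (2 : WithTop ℕ∞) ≠ 0 := two_ne_zero
  have hCa := hΨC.contDiffAt (x := ub)
  have hst := hCa.hasStrictFDerivAt' hΨd' h2
  set g := hCa.localInverse hΨd' h2 with hg
  have hgC : ContDiffAt ℝ 2 g (Ψ ub) := hCa.to_localInverse hΨd' h2
  have hgi : g (Ψ ub) = ub := hCa.localInverse_apply_image hΨd' h2
  have hgr : ∀ᶠ z in 𝓝 (Ψ ub), Ψ (g z) = z := hst.eventually_right_inverse
  -- the base point
  have hxc := clamp_continuous hx.cont
  have hΨub : Ψ ub = iota hd (x 0 - e) := by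
    ext t
    have ht : 0 ≤ max t 0 := le_max_right _ _
    have hdu := duhamel_fwd J (x := fun t => x (max t 0) - e)
      (F := fun t => θ (x (max t 0)) - J (x (max t 0) - e))
      ((S.hθ.continuous.comp hxc).sub (J.continuous.comp (hxc.sub continuous_const)))
      (fun t ht => by
        refine ((clamp_deriv ht (hx.ode t ht)).sub_const e).congr_deriv ?_
        rw [max_eq_left ht]; abel) ht
    have hw := wt_pos K c b D (max t 0)
    have hfw : fwd J (fun s => wt K c b D s • (N ub - mult ℝ E E Jc ub) s) (max t 0) =
        fwd J (fun t => θ (x (max t 0)) - J (x (max t 0) - e)) (max t 0) := by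
      refine fwd_congr J ht fun s hs => ?_
      have h3 := hub s
      rw [aff_apply] at h3
      have hws := (wt_pos K c b D s).ne'
      rw [← h3]
      simp only [N, BoundedContinuousFunction.coe_sub, Pi.sub_apply, wsup_apply, mult_apply,
        wtB_apply, max_eq_left hs, S.hθe, sub_zero, smul_sub, smul_inv_smul₀ hws, Jc,
        BoundedContinuousFunction.const_apply, add_sub_cancel_left, map_smul]
    have h3 := hub t
    rw [aff_apply, wtB_apply] at h3
    simp only [hΨ, BoundedContinuousFunction.coe_sub, Pi.sub_apply, V_apply, iota_apply]
    simp only [BoundedContinuousFunction.coe_sub, Pi.sub_apply] at hfw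
    rw [hfw]
    rw [max_eq_left ht, ← h3, add_sub_cancel_left, max_self] at hdu
    have h4 : ub t = (wt K c b D (max t 0))⁻¹ • (wt K c b D (max t 0) • ub t) := by
      rw [inv_smul_smul₀ hw.ne']
    rw [h4, hdu, smul_add, add_sub_cancel_right]
  set Uf : E → (ℝ →ᵇ E) := fun h => g (iota hd (h - e)) with hUf
  have hin : ContDiff ℝ 2 (fun h : E => iota hd (h - e)) :=
    (iota hd).contDiff.comp (contDiff_id.sub contDiff_const)
  refine ⟨Uf, ?_, ?_, ?_⟩
  · refine ContDiffAt.comp (x 0) (g := g) (f := fun h => iota hd (h - e)) ?_ hin.contDiffAt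
    rw [← hΨub]; exact hgC
  · rw [hUf]; simp only; rw [← hΨub, hgi]
  · rw [hΨub] at hgr
    have := hin.continuous.tendsto (x 0)
    filter_upwards [this.eventually hgr] with h hh
    set u := Uf h with hu
    have hu1 : Ψ u = iota hd (h - e) := hh
    set F : ℝ → E := fun s => wt K c b D s • (N u - mult ℝ E E Jc u) s with hF
    have hFc : Continuous F := (wt_continuous K c b D).smul (N u - mult ℝ E E Jc u).continuous
    have hX : ∀ t, 0 ≤ t → aff e (wtB hd) u t = e + (ex J t (h - e) + fwd J F t) := fun t ht => by
      have hw := wt_pos K c b D t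
      have h5 : u t - (wt K c b D t)⁻¹ • fwd J F t = (wt K c b D t)⁻¹ • ex J t (h - e) := by
        have := congrArg (fun f : ℝ →ᵇ E => f t) hu1
        simp only [hΨ] at this
        rw [iota_apply, max_eq_left ht, BoundedContinuousFunction.coe_sub, Pi.sub_apply,
          V_apply, max_eq_left ht] at this
        exact this
      rw [aff_apply, wtB_apply, max_eq_left ht, sub_eq_iff_eq_add.1 h5, smul_add,
        smul_inv_smul₀ hw.ne', smul_inv_smul₀ hw.ne']
    refine ⟨?_, ?_, ?_⟩
    · rw [hX 0 le_rfl, ex_zero, fwd_zero]; simp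
    · intro t ht
      have h6 : HasDerivAt (fun t => e + (ex J t (h - e) + fwd J F t))
          (J (ex J t (h - e)) + (J (fwd J F t) + F t)) t := by
        refine ((HasDerivAt.add ?_ (fwd_hasDerivAt J hFc t))).const_add e
        have := (ex_hasDerivAt J t).clm_apply (hasDerivAt_const t (h - e))
        simpa using this
      refine (h6.hasDerivWithinAt.congr (fun s hs => hX s hs) (hX t ht)).congr_deriv ?_
      have h7 : F t = θ (aff e (wtB hd) u t) - J (aff e (wtB hd) u t - e) := by
        have hws := (wt_pos K c b D t).ne'
        simp only [F, N, BoundedContinuousFunction.coe_sub, Pi.sub_apply, wsup_apply, mult_apply,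
          wtB_apply, max_eq_left ht, S.hθe, sub_zero, smul_sub, smul_inv_smul₀ hws, Jc,
          BoundedContinuousFunction.const_apply, add_sub_cancel_left, map_smul, aff_apply]
      rw [h7, ← add_assoc, ← map_add]
      have h8 : ex J t (h - e) + fwd J F t = aff e (wtB hd) u t - e := by
        rw [hX t ht]; abel
      rw [h8]; abel
    · rw [tendsto_iff_norm_sub_tendsto_zero]
      have hc1 : 0 < c - 2 * K * b := by linarith [hd.hc]
      have h9 : Tendsto (fun t : ℝ => Real.exp (-(c - 2 * K * b) * t) * ‖u‖) atTop (𝓝 0) := by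
        have h1 : Tendsto (fun t : ℝ => -(c - 2 * K * b) * t) atTop atBot :=
          tendsto_id.const_mul_atTop_of_neg (by linarith)
        have := (Real.tendsto_exp_atBot.comp h1).mul_const ‖u‖
        rw [zero_mul] at this
        exact this
      refine squeeze_zero' (Eventually.of_forall fun t => norm_nonneg _) ?_ h9
      filter_upwards [eventually_ge_atTop 0] with t ht
      rw [aff_apply, add_sub_cancel_left, norm_smul, wtB_apply, max_eq_left ht,
        Real.norm_of_nonneg (wt_pos _ _ _ _ _).le]
      exact mul_le_mul (wt_le_exp hd t) (u.norm_coe_le_norm t) (norm_nonneg _) (Real.exp_pos _).le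

end LocalThm

end DensReg


namespace DensReg

open Set Filter Topology BoundedContinuousFunction MeasureTheory
open scoped NNReal


set_option linter.unusedSectionVars false
set_option linter.unusedSimpArgs false

section LocalThm

variable {E : Type*} [NormedAddCommGroup E] [NormedSpace ℝ E] [CompleteSpace E]
variable {θ : E → E} {M : E → E →L[ℝ] E} {e v : E} {K c K2 : ℝ}

/-- The function `w2⁻¹ v`. -/
noncomputable def pv {M0 : E →L[ℝ] E} {K2 C c1 : ℝ} {w : ℝ → ℝ} (bd : BwdData M0 K2 C c1 w)
    (v : E) : ℝ →ᵇ E :=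
  BoundedContinuousFunction.ofNormedAddCommGroup (fun t => (w2 K2 C c1 (max t 0))⁻¹ • v)
    ((((w2_continuous K2 C c1).comp (continuous_id.max continuous_const)).inv₀
      fun t => (w2_pos _ _ _ _).ne').smul continuous_const) ‖v‖
    (fun t => by
      rw [norm_smul, norm_inv, Real.norm_of_nonneg (w2_pos _ _ _ _).le]
      exact mul_le_of_le_one_left (norm_nonneg _) (inv_le_one_of_one_le₀ (w2_one_le bd _)))

lemma pv_apply {M0 : E →L[ℝ] E} {K2 C c1 : ℝ} {w : ℝ → ℝ} (bd : BwdData M0 K2 C c1 w)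
    (v : E) (t : ℝ) : pv bd v t = (w2 K2 C c1 (max t 0))⁻¹ • v := rfl

/-- From a fixed point of the weighted integral equation to a solution of the linear ODE. -/
lemma solY_of_fixed {x : ℝ → E} {C c1 : ℝ} {w : ℝ → ℝ} (bd : BwdData (M e) K2 C c1 w)
    (hMv : M e v = 0)
    (B : ℝ →ᵇ (E →L[ℝ] E)) (hB : ∀ t, 0 ≤ t → w t • B t = M (x t) - M e) (ζ : ℝ →ᵇ E)
    (hζ : ζ = R bd (mult ℝ E E B (ζ + pv bd v))) :
    SolY M v x (fun t => v + w2 K2 C c1 (max t 0) • ζ t) := by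
  set g := mult ℝ E E B (ζ + pv bd v) with hg
  have hY : ∀ t, 0 ≤ t → v + w2 K2 C c1 (max t 0) • ζ t = v + bwd (M e) (rint K2 C c1 w g) t := by
    intro t ht
    have := congrArg (fun f : ℝ →ᵇ E => f t) hζ
    simp only [R_apply, max_eq_left ht] at this
    rw [max_eq_left ht, this, smul_inv_smul₀ (w2_pos _ _ _ _).ne']
  constructor
  · intro t ht
    have h1 := (bwd_hasDerivAt (M e) (rint_cont bd g.continuous) t).const_add v
    refine (h1.hasDerivWithinAt.congr (fun s hs => hY s hs) (hY t ht)).congr_deriv ?_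
    have h2 : rint K2 C c1 w g t = (M (x t) - M e) (v + w2 K2 C c1 (max t 0) • ζ t) := by
      rw [← hB t ht]
      simp only [rint, g, mult_apply, BoundedContinuousFunction.coe_add, Pi.add_apply, pv_apply,
        max_eq_left ht, map_add, smul_add, map_smul, _root_.smul_apply]
      rw [smul_comm (w t) _ (B t v), smul_inv_smul₀ (w2_pos _ _ _ _).ne', add_comm]
    have h3 : bwd (M e) (rint K2 C c1 w g) t = (v + w2 K2 C c1 (max t 0) • ζ t) - v := by
      rw [hY t ht, add_sub_cancel_left]
    rw [h2, h3, map_sub, hMv, sub_zero, _root_.sub_apply]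
    abel
  · have h1 := (bwd_tendsto bd (rint_cont bd g.continuous) (rint_bd bd g)).const_add v
    rw [add_zero] at h1
    refine h1.congr' ?_
    filter_upwards [eventually_ge_atTop 0] with t ht
    exact (hY t ht).symm

/-- The local theorem. -/
theorem local_main (S : Sys θ M e v K c K2) {x : ℝ → E} (hx : SolX θ e x) {ε : ℝ} (hε : 0 < ε) :
    ∃ X Y : E → ℝ → E, ContDiffAt ℝ 2 (fun h => Y h 0) (x 0) ∧
      ∀ᶠ h in 𝓝 (x 0), X h 0 = h ∧ SolX θ e (X h) ∧ (∀ t, 0 ≤ t → ‖X h t - x t‖ < ε) ∧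
        SolY M v (X h) (Y h) := by
  obtain ⟨b, D, hd, hD1, hF⟩ := exists_fwdData S hx
  obtain ⟨C1, hC1, hdec⟩ := hx.decay S hd hF
  have hxc := clamp_continuous hx.cont
  have hm : Continuous fun t : ℝ => max t 0 := continuous_id.max continuous_const
  have hwp : ∀ t, 0 < wtB hd t := fun t => wt_pos _ _ _ _ _
  set ub : ℝ →ᵇ E := BoundedContinuousFunction.ofNormedAddCommGroup
    (fun t => (wtB hd t)⁻¹ • (x (max t 0) - e))
    (((wtB hd).continuous.inv₀ fun t => (hwp t).ne').smul (hxc.sub continuous_const)) C1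
    (fun t => by
      rw [norm_smul, norm_inv, Real.norm_of_nonneg (hwp t).le, inv_mul_le_iff₀ (hwp t), mul_comm]
      exact hdec _ (le_max_right _ _)) with hubdef
  have hub : ∀ t, aff e (wtB hd) ub t = x (max t 0) := fun t => by
    rw [aff_apply]
    simp only [ub, BoundedContinuousFunction.coe_ofNormedAddCommGroup,
      smul_inv_smul₀ (hwp t).ne', add_sub_cancel]
  obtain ⟨Uf, hUC, hU0, hUe⟩ := local_fwd S hx hd hD1 hub
  have hMC1 : ContDiff ℝ 1 M := S.hM.of_le one_le_two
  obtain ⟨L, hL⟩ := hMC1.lipschitzWith_of_hasCompactSupport S.hMs one_ne_zero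
  set C := L * C1 + 1 with hC
  have hCp : 0 < C := by positivity
  have bd : BwdData (M e) K2 C (c - 2 * K * b) (wt K c b D) :=
    ⟨S.hM2, S.hK2, hCp, by linarith [hd.hc], wt_continuous _ _ _ _, fun s _ => by
      rw [abs_of_pos (wt_pos _ _ _ _ _)]; exact wt_le_exp hd s⟩
  have hMx : ∀ s, 0 ≤ s → ‖M (x s) - M e‖ ≤ C * Real.exp (-(c - 2 * K * b) * s) := fun s hs => by
    have h3 := hL.dist_le_mul (x s) e
    rw [dist_eq_norm, dist_eq_norm] at h3
    have h4 := hdec s hs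
    have h5 := wt_le_exp hd s
    have h6 : (L : ℝ) * ‖x s - e‖ ≤ L * (C1 * Real.exp (-(c - 2 * K * b) * s)) :=
      mul_le_mul_of_nonneg_left (h4.trans (mul_le_mul_of_nonneg_left h5 hC1)) L.2
    have h7 := Real.exp_pos (-(c - 2 * K * b) * s)
    rw [hC]; nlinarith
  set B : E → (ℝ →ᵇ (E →L[ℝ] E)) := fun h => wsup M L hL e (wtB hd) hwp (Uf h) with hBdef
  have hBC : ContDiffAt ℝ 2 B (x 0) :=
    ((wsup_contDiff M L hL e (wtB hd) hwp S.hM S.hMs).contDiffAt).comp (x 0) hUC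
  have hBv : ∀ h t, 0 ≤ t → wt K c b D t • B h t = M (aff e (wtB hd) (Uf h) t) - M e := by
    intro h t ht
    simp only [B, wsup_apply, aff_apply, wtB_apply, max_eq_left ht,
      smul_inv_smul₀ (wt_pos K c b D t).ne']
  set T : E → ((ℝ →ᵇ E) →L[ℝ] (ℝ →ᵇ E)) := fun h => (R bd).comp (mult ℝ E E (B h)) with hTdef
  have hTC : ContDiffAt ℝ 2 T (x 0) :=
    have h0 : ContDiff ℝ 2 (fun b => mult ℝ E E b) :=
      by fun_prop
    have h1 : ContDiffAt ℝ 2 (fun h => mult ℝ E E (B h)) (x 0) :=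
      h0.contDiffAt.comp (x 0) hBC
    contDiffAt_const.clm_comp h1
  have hTn : ‖T (x 0)‖ ≤ 1 / 2 := by
    refine ContinuousLinearMap.opNorm_le_bound _ (by norm_num) fun k => ?_
    have := R_norm_le bd (mult ℝ E E (B (x 0)) k) (G := ‖k‖) (norm_nonneg _) (fun s hs => by
      rw [mult_apply, ← _root_.smul_apply, hBv _ s hs, hU0, hub, max_eq_left hs]
      exact (ContinuousLinearMap.le_opNorm _ _).trans
        (mul_le_mul (hMx s hs) (k.norm_coe_le_norm s) (norm_nonneg _) (by positivity)))
    refine this.trans_eq (by ring)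
  obtain ⟨un, hun⟩ := exists_equiv_one_sub _ hTn
  have hinvC : ContDiffAt ℝ 2 (fun h => Ring.inverse (1 - T h)) (x 0) := by
    refine ContDiffAt.comp (x 0) (g := Ring.inverse) (f := fun h => 1 - T h) ?_
      (contDiffAt_const.sub hTC)
    rw [← hun]; exact contDiffAt_ringInverse ℝ un
  set ζ : E → (ℝ →ᵇ E) := fun h => Ring.inverse (1 - T h) (T h (pv bd v)) with hζdef
  have hζC : ContDiffAt ℝ 2 ζ (x 0) := hinvC.clm_apply (hTC.clm_apply contDiffAt_const)
  refine ⟨fun h => aff e (wtB hd) (Uf h),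
    fun h t => v + w2 K2 C (c - 2 * K * b) (max t 0) • ζ h t, ?_, ?_⟩
  · refine contDiffAt_const.add (contDiffAt_const.smul ?_)
    exact (BoundedContinuousFunction.evalCLM ℝ (0 : ℝ)).contDiff.contDiffAt.comp (x 0) hζC
  · have hunit : ∀ᶠ h in 𝓝 (x 0), IsUnit (1 - T h) := by
      have h1 : ContinuousAt (fun h => 1 - T h) (x 0) := continuousAt_const.sub hTC.continuousAt
      exact h1.eventually (Units.isOpen.mem_nhds ⟨un, hun⟩)
    have hnear : ∀ᶠ h in 𝓝 (x 0), ‖Uf h - ub‖ < ε := by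
      have := Metric.tendsto_nhds.1 hUC.continuousAt ε hε
      simpa only [hU0, dist_eq_norm] using this
    filter_upwards [hUe, hunit, hnear] with h h1 h2 h3
    refine ⟨h1.1, h1.2, fun t ht => ?_, ?_⟩
    · have h4 := hub t
      rw [max_eq_left ht] at h4
      rw [← h4, aff_apply, aff_apply, add_sub_add_left_eq_sub, ← smul_sub, norm_smul,
        Real.norm_of_nonneg (hwp t).le]
      refine lt_of_le_of_lt ?_ h3
      refine (mul_le_of_le_one_left (norm_nonneg _) ?_).trans ((Uf h - ub).norm_coe_le_norm t)
      rw [wtB_apply]; exact wt_le_one hd (le_max_right _ _)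
    · refine solY_of_fixed bd S.hMv (B h) (hBv h) (ζ h) ?_
      have h5 : (1 - T h) (ζ h) = T h (pv bd v) := by
        have := congrArg (fun f : (ℝ →ᵇ E) →L[ℝ] (ℝ →ᵇ E) => f (T h (pv bd v)))
          (Ring.mul_inverse_cancel _ h2)
        exact this
      have h6 : ζ h - T h (ζ h) = T h (pv bd v) := h5
      have h7 := sub_eq_iff_eq_add.1 h6
      rw [add_comm, ← map_add] at h7
      exact h7

end LocalThm

end DensReg


namespace DensReg

open Set Filter Topology BoundedContinuousFunction MeasureTheory
open scoped NNReal


set_option linter.unusedSectionVars false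
set_option linter.unusedSimpArgs false

section Hurwitz

lemma exp_eigvec {V : Type*} [NormedAddCommGroup V] [NormedSpace ℂ V] [CompleteSpace V]
    (a : V →L[ℂ] V) (l : ℂ) (w : V) (h : a w = l • w) :
    NormedSpace.exp a w = Complex.exp l • w := by
  have h1 := NormedSpace.exp_series_hasSum_exp' (𝕂 := ℂ) a
  have h2 := (ContinuousLinearMap.apply ℂ V w).hasSum h1
  have h3 := NormedSpace.exp_series_hasSum_exp' (𝕂 := ℂ) l
  have h4 := h3.smul_const w
  have hp : ∀ n : ℕ, (a ^ n) w = l ^ n • w := by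
    intro n
    induction n with
    | zero => simp
    | succ n ih =>
      rw [pow_succ', pow_succ', mul_apply_eq_comp, ih, map_smul, h, smul_smul, mul_comm]
  rw [Complex.exp_eq_exp_ℂ]
  refine h2.unique ?_
  convert! h4 using 1
  funext n
  simp [hp, smul_smul]

lemma cplx_spec {V : Type*} [NormedAddCommGroup V] [NormedSpace ℂ V] [FiniteDimensional ℂ V]
    [CompleteSpace V] [Nontrivial V] (a : V →L[ℂ] V)
    (h : ∀ (l : ℂ) (w : V), w ≠ 0 → a w = l • w → l.re < 0) :
    ∃ n : ℕ, 1 ≤ n ∧ ‖(NormedSpace.exp a) ^ n‖ < 1 := by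
  set f := NormedSpace.exp a with hf
  have hcomm : ∀ x, a (f x) = f (a x) := fun x => by
    have : Commute a f := (Commute.refl a).exp_right
    exact congrArg (fun g : V →L[ℂ] V => g x) this.eq
  have hspec : ∀ k ∈ spectrum ℂ f, ‖k‖ < 1 := by
    intro k hk
    have hker : ∃ w, w ≠ 0 ∧ f w = k • w := by
      by_contra hcon
      push Not at hcon
      apply hk
      have hinj : Function.Injective ((algebraMap ℂ (V →L[ℂ] V) k - f : V →L[ℂ] V) : V →ₗ[ℂ] V) := by
        rw [← LinearMap.ker_eq_bot, LinearMap.ker_eq_bot']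
        intro w hw
        by_contra hw0
        refine hcon w hw0 ?_
        have : k • w - f w = 0 := by
          simpa [Algebra.algebraMap_eq_smul_one] using hw
        exact (sub_eq_zero.1 this).symm
      set L := (LinearEquiv.ofInjectiveEndo _ hinj).toContinuousLinearEquiv
      refine ⟨(ContinuousLinearEquiv.unitsEquiv ℂ V).symm L, ?_⟩
      ext w; rfl
    obtain ⟨w, hw0, hw⟩ := hker
    set W := Module.End.eigenspace (f : V →ₗ[ℂ] V) k with hW
    have hmap : ∀ x ∈ W, (a : V →ₗ[ℂ] V) x ∈ W := by
      intro x hx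
      rw [hW, Module.End.mem_eigenspace_iff] at hx ⊢
      have hx' : f x = k • x := hx
      change f (a x) = k • a x
      rw [← hcomm, hx', map_smul]
    have hwW : w ∈ W := Module.End.mem_eigenspace_iff.2 hw
    have : Nontrivial W := ⟨⟨⟨w, hwW⟩, 0, fun h => hw0 (congrArg Subtype.val h)⟩⟩
    obtain ⟨l, hl⟩ := Module.End.exists_eigenvalue ((a : V →ₗ[ℂ] V).restrict hmap)
    obtain ⟨z, hz⟩ := hl.exists_hasEigenvector
    have hz0 : (z : V) ≠ 0 := fun h => hz.2 (Subtype.ext h)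
    have hz1 : a z = l • (z : V) := congrArg Subtype.val hz.apply_eq_smul
    have hz2 : f z = k • (z : V) := Module.End.mem_eigenspace_iff.1 z.2
    have hz3 := exp_eigvec a l z hz1
    rw [← hf, hz2] at hz3
    have hk' : k = Complex.exp l := smul_left_injective ℂ hz0 hz3
    rw [hk', Complex.norm_exp]
    exact Real.exp_lt_one_iff.2 (h l z hz0 hz1)
  obtain ⟨k, hk, hk1⟩ := spectrum.exists_nnnorm_eq_spectralRadius f
  have hr : spectralRadius ℂ f < 1 := by
    rw [← hk1]
    exact_mod_cast hspec k hk
  have hlim := spectrum.pow_nnnorm_pow_one_div_tendsto_nhds_spectralRadius f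
  obtain ⟨n, hn1, hn⟩ := ((hlim.eventually (gt_mem_nhds hr)).and (eventually_ge_atTop 1)).exists
  refine ⟨n, hn, ?_⟩
  by_contra hcon
  push Not at hcon
  have h1 : (1 : ENNReal) ≤ (‖f ^ n‖₊ : ENNReal) := by exact_mod_cast hcon
  have := ENNReal.one_le_rpow h1 (z := 1 / (n : ℝ)) (by positivity)
  exact absurd hn1 (not_lt.2 this)

lemma decay_of_contr {E : Type*} [NormedAddCommGroup E] [NormedSpace ℝ E] [CompleteSpace E]
    (J : E →L[ℝ] E) {T : ℝ} (hT : 0 < T) (h : ‖ex J T‖ < 1) :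
    ∃ K c, 0 < K ∧ 0 < c ∧ ∀ r, 0 ≤ r → ‖ex J r‖ ≤ K * Real.exp (-c * r) := by
  obtain ⟨S, hS⟩ := (isCompact_Icc (a := (0 : ℝ)) (b := T)).exists_bound_of_continuousOn
    (ex_continuous J).continuousOn
  set r := max ‖ex J T‖ (1 / 2) with hr
  have hr0 : 0 < r := lt_of_lt_of_le (by norm_num) (le_max_right _ _)
  have hr1 : r < 1 := max_lt h (by norm_num)
  have hlog : Real.log r < 0 := Real.log_neg hr0 hr1
  have hS0 : 0 ≤ S := (norm_nonneg _).trans (hS 0 ⟨le_rfl, hT.le⟩)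
  have hpow : ∀ m : ℕ, ∀ s, 0 ≤ s → s ≤ T → ‖ex J (m * T + s)‖ ≤ r ^ m * S := by
    intro m
    induction m with
    | zero => intro s h1 h2; simpa using hS s ⟨h1, h2⟩
    | succ m ih =>
      intro s h1 h2
      have e1 : ((m + 1 : ℕ) : ℝ) * T + s = T + (m * T + s) := by push_cast; ring
      rw [e1, ex_add, pow_succ', mul_assoc]
      exact (norm_mul_le _ _).trans
        (mul_le_mul (le_max_left _ _) (ih s h1 h2) (norm_nonneg _) hr0.le)
  refine ⟨r⁻¹ * (S + 1), -Real.log r / T, by positivity, div_pos (by linarith) hT, fun t ht => ?_⟩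
  set m := ⌊t / T⌋₊ with hm
  have hm1 : (m : ℝ) ≤ t / T := Nat.floor_le (by positivity)
  have hm2 : t / T < m + 1 := Nat.lt_floor_add_one _
  rw [le_div_iff₀ hT] at hm1
  have hm2' := hm2
  rw [div_lt_iff₀ hT] at hm2
  have h1 := hpow m (t - m * T) (by linarith) (by linarith)
  rw [add_sub_cancel] at h1
  have h2 : r ^ m ≤ r⁻¹ * Real.exp (-(-Real.log r / T) * t) := by
    have e1 : r ^ m = Real.exp (m * Real.log r) := by
      rw [Real.exp_nat_mul, Real.exp_log hr0]
    have e2 : r⁻¹ = Real.exp (-Real.log r) := by rw [Real.exp_neg, Real.exp_log hr0]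
    rw [e1, e2, ← Real.exp_add, Real.exp_le_exp]
    have e3 : -(-Real.log r / T) * t = Real.log r * (t / T) := by ring
    rw [e3]
    nlinarith
  have h3 : 0 ≤ r⁻¹ * Real.exp (-(-Real.log r / T) * t) := by positivity
  calc ‖ex J t‖ ≤ r ^ m * S := h1
    _ ≤ (r⁻¹ * Real.exp (-(-Real.log r / T) * t)) * (S + 1) :=
      mul_le_mul h2 (by linarith) hS0 h3
    _ = _ := by ring

/-- Exponential decay of the real matrix exponential from the complex spectrum. -/
lemma hurwitz (q : ℕ) (hq : 1 ≤ q) (J : (Fin q → ℝ) →L[ℝ] (Fin q → ℝ)) (A : Matrix (Fin q) (Fin q) ℝ)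
    (hJA : ∀ x, J x = A.mulVec x)
    (hs : ∀ z : ℂ, (Matrix.charpoly (A.map Complex.ofReal)).IsRoot z → z.re < 0) :
    ∃ K c, 0 < K ∧ 0 < c ∧ ∀ r, 0 ≤ r → ‖ex J r‖ ≤ K * Real.exp (-c * r) := by
  have : Nonempty (Fin q) := ⟨⟨0, hq⟩⟩
  set a : (Fin q → ℂ) →L[ℂ] (Fin q → ℂ) :=
    LinearMap.toContinuousLinearMap (Matrix.toLin' (A.map Complex.ofReal)) with ha
  have hav : ∀ w, a w = (A.map Complex.ofReal).mulVec w := fun w => rfl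
  obtain ⟨n, hn, hn1⟩ := cplx_spec a (fun l w hw h => by
    apply hs
    rw [← Matrix.mem_spectrum_iff_isRoot_charpoly, ← Matrix.spectrum_toLin',
      ← Module.End.hasEigenvalue_iff_mem_spectrum]
    exact Module.End.hasEigenvalue_of_hasEigenvector (x := w)
      ⟨Module.End.mem_eigenspace_iff.2 h, hw⟩)
  refine decay_of_contr J (T := n) (by exact_mod_cast hn) (lt_of_le_of_lt ?_ hn1)
  set i : (Fin q → ℝ) →L[ℝ] (Fin q → ℂ) :=
    ContinuousLinearMap.pi fun k => Complex.ofRealCLM.comp (ContinuousLinearMap.proj k) with hi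
  have hiv : ∀ x k, i x k = (x k : ℂ) := fun x k => rfl
  have hin : ∀ x, ‖i x‖ = ‖x‖ := fun x => by
    simp only [Pi.norm_def]
    congr 1
    refine Finset.sup_congr rfl fun k _ => ?_
    rw [hiv]; ext; simp
  have hia : ∀ x, i (J x) = a (i x) := fun x => by
    funext k
    rw [hiv, hJA, hav]
    simp [Matrix.mulVec, dotProduct, hiv]
  have z0 : (0 : ℝ) • a = 0 := by
    refine ContinuousLinearMap.ext fun w => ?_
    exact zero_smul ℝ (a w)
  have z1 : ∀ s : ℝ, (s + 1) • a = s • a + a := fun s => by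
    refine ContinuousLinearMap.ext fun w => ?_
    change (s + 1) • a w = s • a w + a w
    rw [add_smul, one_smul]
  have hd : ∀ x, ∀ t : ℝ, NormedSpace.exp (t • a) (i x) = i (ex J t x) := by
    intro x t
    have hder : ∀ s : ℝ, HasDerivAt
        (fun s : ℝ => NormedSpace.exp ((t - s) • a) (i (ex J s x))) 0 s := by
      intro s
      have h1 : HasDerivAt (fun s : ℝ => NormedSpace.exp ((t - s) • a))
          (-(NormedSpace.exp ((t - s) • a) * a)) s := by
        have := (hasDerivAt_exp_smul_const (𝕂 := ℝ) a (t - s)).scomp s ((hasDerivAt_id s).const_sub t)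
        rw [neg_one_smul] at this
        exact this
      have h2 : HasDerivAt (fun s : ℝ => i (ex J s x)) (i (J (ex J s x))) s := by
        have := (ex_hasDerivAt J s).clm_apply (hasDerivAt_const s x)
        have h3 := i.hasFDerivAt.comp_hasDerivAt s this
        simpa using! h3
      have h1' : HasDerivAt (fun s : ℝ => (NormedSpace.exp ((t - s) • a)).restrictScalars ℝ)
          ((-(NormedSpace.exp ((t - s) • a) * a)).restrictScalars ℝ) s :=
        (ContinuousLinearMap.restrictScalarsL ℂ (Fin q → ℂ) (Fin q → ℂ) ℝ ℝ).hasFDerivAt.comp_hasDerivAt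
          s h1
      have := h1'.clm_apply h2
      refine this.congr_deriv ?_
      simp [hia]
    have hconst := is_const_of_deriv_eq_zero (fun s => (hder s).differentiableAt)
      (fun s => (hder s).deriv) 0 t
    have e0 : NormedSpace.exp ((0 : ℝ) • a) = 1 := by rw [z0, NormedSpace.exp_zero]
    simp only [sub_self, sub_zero] at hconst
    rw [e0, ex_zero] at hconst
    exact hconst
  refine ContinuousLinearMap.opNorm_le_bound _ (norm_nonneg _) fun x => ?_
  rw [← hin, ← hd, ← hin x]
  have : NormedSpace.exp ((n : ℝ) • a) = NormedSpace.exp a ^ n := by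
    clear hn hn1
    induction n with
    | zero => rw [Nat.cast_zero, z0, NormedSpace.exp_zero, pow_zero]
    | succ n ih =>
      rw [Nat.cast_succ, z1, pow_succ, ← ih]
      exact NormedSpace.exp_add_of_commute_of_mem_ball (𝕂 := ℂ)
        (ContinuousLinearMap.ext fun w =>
          ((a.restrictScalars ℝ).map_smul (n : ℝ) (a w)).symm)
        ((NormedSpace.expSeries_radius_eq_top ℂ ((Fin q → ℂ) →L[ℂ] (Fin q → ℂ))).symm ▸ edist_lt_top _ _)
        ((NormedSpace.expSeries_radius_eq_top ℂ ((Fin q → ℂ) →L[ℂ] (Fin q → ℂ))).symm ▸ edist_lt_top _ _)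
  rw [this]
  exact ContinuousLinearMap.le_opNorm _ _

end Hurwitz

section Metzler

variable {q : ℕ}

lemma ex_nonneg (N : (Fin q → ℝ) →L[ℝ] (Fin q → ℝ)) (hN : ∀ u, 0 ≤ u → 0 ≤ N u) {t : ℝ}
    (ht : 0 ≤ t) (u : Fin q → ℝ) (hu : 0 ≤ u) : 0 ≤ ex N t u := by
  have h1 := NormedSpace.exp_series_hasSum_exp' (𝕂 := ℝ) (t • N)
  have h2 := (ContinuousLinearMap.apply ℝ (Fin q → ℝ) u).hasSum h1
  have hp : ∀ n : ℕ, 0 ≤ ((t • N) ^ n) u := by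
    intro n
    induction n with
    | zero => simpa using hu
    | succ n ih =>
      rw [pow_succ', mul_apply_eq_comp]
      exact smul_nonneg ht (hN _ ih)
  intro i
  refine hasSum_le (fun n => ?_) hasSum_zero (Pi.hasSum.1 h2 i)
  exact mul_nonneg (by positivity) (hp n i)

lemma metzler (M : (Fin q → ℝ) →L[ℝ] (Fin q → ℝ)) (A : Matrix (Fin q) (Fin q) ℝ)
    (hMA : ∀ x, M x = A.mulVec x) (hoff : ∀ i j, i ≠ j → 0 ≤ A i j) (v : Fin q → ℝ)
    (hv : ∀ i, 0 < v i) (hMv : M v = 0) : ∃ K, 0 < K ∧ ∀ r, 0 ≤ r → ‖ex M r‖ ≤ K := by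
  set k := ∑ i, |A i i| with hk
  have hki : ∀ i, 0 ≤ A i i + k := fun i => by
    have h1 : |A i i| ≤ k :=
      Finset.single_le_sum (f := fun i => |A i i|) (fun _ _ => abs_nonneg _) (Finset.mem_univ i)
    have := neg_abs_le (A i i)
    linarith
  set N := M + k • (1 : (Fin q → ℝ) →L[ℝ] (Fin q → ℝ)) with hN
  have hNp : ∀ u, 0 ≤ u → 0 ≤ N u := by
    intro u hu i
    have e1 : N u i = ∑ j, A i j * u j + k * u i := by
      simp [hN, hMA, Matrix.mulVec, dotProduct]
    rw [e1, ← Finset.add_sum_erase _ _ (Finset.mem_univ i)]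
    have h1 : 0 ≤ ∑ j ∈ Finset.univ.erase i, A i j * u j :=
      Finset.sum_nonneg fun j hj => mul_nonneg (hoff i j (Finset.ne_of_mem_erase hj).symm) (hu j)
    have h2 : 0 ≤ (A i i + k) * u i := mul_nonneg (hki i) (hu i)
    change (0 : ℝ) ≤ _
    nlinarith
  have hex : ∀ t, 0 ≤ t → ∀ u, Real.exp (-k * t) • ex N t u = ex M t u := by
    intro t ht u
    have := duhamel_fwd M (x := fun t => Real.exp (-k * t) • ex N t u) (F := fun _ => 0)
      continuous_const (fun s hs => by
        have h1 : HasDerivAt (fun t : ℝ => Real.exp (-k * t)) (Real.exp (-k * s) * (-k * 1)) s :=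
          ((hasDerivAt_id s).const_mul (-k)).exp
        have h2 := (ex_hasDerivAt N s).clm_apply (hasDerivAt_const s u)
        refine (h1.smul h2).hasDerivWithinAt.congr_deriv ?_
        have e1 : (N * ex N s) u = M (ex N s u) + k • ex N s u := by
          rw [mul_apply_eq_comp]; rfl
        simp only [map_zero, add_zero, map_smul, e1]
        module) ht
    simpa [fwd, ex_zero] using this
  have hpos : ∀ t, 0 ≤ t → ∀ u, 0 ≤ u → 0 ≤ ex M t u := fun t ht u hu => by
    rw [← hex t ht]
    exact smul_nonneg (Real.exp_pos _).le (ex_nonneg N hNp ht u hu)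
  have hfix : ∀ t, 0 ≤ t → ex M t v = v := by
    intro t ht
    have := duhamel_fwd M (x := fun _ => v) (F := fun _ => 0)
      continuous_const (fun s hs => by simpa [hMv] using hasDerivWithinAt_const s (Ici 0) v) ht
    simpa [fwd] using this.symm
  set m := ∑ i, (v i)⁻¹ with hm
  have hmi : ∀ i, (v i)⁻¹ ≤ m := fun i =>
    Finset.single_le_sum (f := fun i => (v i)⁻¹) (fun i _ => (inv_pos.2 (hv i)).le)
      (Finset.mem_univ i)
  have hm0 : 0 ≤ m := Finset.sum_nonneg fun i _ => (inv_pos.2 (hv i)).le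
  refine ⟨m * ‖v‖ + 1, by positivity, fun t ht => ?_⟩
  refine ContinuousLinearMap.opNorm_le_bound _ (by positivity) fun u => ?_
  have hu : ∀ i, |u i| ≤ ‖u‖ * m * v i := fun i => by
    have h1 : |u i| ≤ ‖u‖ := norm_le_pi_norm u i
    have h2 : 1 ≤ m * v i := by
      have := mul_le_mul_of_nonneg_right (hmi i) (hv i).le
      rwa [inv_mul_cancel₀ (hv i).ne'] at this
    nlinarith [norm_nonneg u]
  have h1 := hpos t ht ((‖u‖ * m) • v - u) (fun i => by
    have := (le_abs_self _).trans (hu i); simpa using this)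
  have h2 := hpos t ht ((‖u‖ * m) • v + u) (fun i => by
    have := (neg_abs_le (u i)); have := hu i
    simp only [Pi.zero_apply, Pi.add_apply, Pi.smul_apply, smul_eq_mul]; linarith)
  rw [map_sub, map_smul, hfix t ht] at h1
  rw [map_add, map_smul, hfix t ht] at h2
  refine (pi_norm_le_iff_of_nonneg (by positivity)).2 fun i => ?_
  have h3 := h1 i
  have h4 := h2 i
  simp only [Pi.zero_apply, Pi.add_apply, Pi.sub_apply, Pi.smul_apply, smul_eq_mul] at h3 h4
  have h5 : v i ≤ ‖v‖ := (le_abs_self _).trans (norm_le_pi_norm v i)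
  have h6 : ‖u‖ * m * v i ≤ ‖u‖ * m * ‖v‖ := mul_le_mul_of_nonneg_left h5 (by positivity)
  rw [Real.norm_eq_abs, abs_le]
  have := norm_nonneg u
  constructor <;> nlinarith

end Metzler

end DensReg


namespace DensReg

open Set Filter Topology BoundedContinuousFunction MeasureTheory
open scoped NNReal


set_option linter.unusedSectionVars false
set_option linter.unusedSimpArgs false

section Global

variable {E : Type*} [NormedAddCommGroup E] [NormedSpace ℝ E] [FiniteDimensional ℝ E]

/-- Data on an open set. -/
structure Glob (U : Set E) (θ : E → E) (M : E → E →L[ℝ] E) (e v : E) (K c K2 : ℝ) : Prop where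
  hU : IsOpen U
  he : e ∈ U
  hθ : ContDiffOn ℝ 2 θ U
  hM : ContDiffOn ℝ 2 M U
  hθe : θ e = 0
  hMv : M e v = 0
  hK : 0 < K
  hc : 0 < c
  hJ : ∀ r, 0 ≤ r → ‖ex (fderiv ℝ θ e) r‖ ≤ K * Real.exp (-c * r)
  hK2 : 0 < K2
  hM2 : ∀ r, 0 ≤ r → ‖ex (M e) r‖ ≤ K2

/-- Solutions inside the open set. -/
structure Sol (U : Set E) (θ : E → E) (M : E → E →L[ℝ] E) (e v : E) (x y : ℝ → E) : Prop where
  mem : ∀ t, 0 ≤ t → x t ∈ U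
  sx : SolX θ e x
  sy : SolY M v x y

variable {U : Set E} {θ : E → E} {M : E → E →L[ℝ] E} {e v : E} {K c K2 : ℝ}

lemma smul_cut {F : Type*} [NormedAddCommGroup F] [NormedSpace ℝ F] {f : E → F} {χ : E → ℝ}
    (hU : IsOpen U) (hf : ContDiffOn ℝ 2 f U) (hχ : ContDiff ℝ 2 χ) (hs : tsupport χ ⊆ U) :
    ContDiff ℝ 2 fun w => χ w • f w := by
  refine contDiff_iff_contDiffAt.2 fun w => ?_
  by_cases hw : w ∈ tsupport χ
  · exact hχ.contDiffAt.smul (hf.contDiffAt (hU.mem_nhds (hs hw)))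
  · have h0 : (fun w => χ w • f w) =ᶠ[𝓝 w] fun _ => 0 := by
      filter_upwards [(isClosed_tsupport χ).isOpen_compl.mem_nhds hw] with z hz
      rw [image_eq_zero_of_notMem_tsupport hz, zero_smul]
    exact contDiffAt_const.congr_of_eventuallyEq h0

lemma cutoff (G : Glob U θ M e v K c K2) {C : Set E} (hC : IsCompact C) (hCU : C ⊆ U)
    (heC : e ∈ C) : ∃ ε > 0, ∃ θ' M', Sys θ' M' e v K c K2 ∧
      ∀ z ∈ C, ∀ w, ‖w - z‖ < ε → w ∈ U ∧ θ' w = θ w ∧ M' w = M w := by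
  have := FiniteDimensional.proper ℝ E
  obtain ⟨δ, hδ, hsub⟩ := hC.exists_cthickening_subset_open G.hU hCU
  obtain ⟨f, hf0, hf1, -⟩ := exists_contMDiffMap_zero_one_of_isClosed (n := 2)
    (modelWithCornersSelf ℝ E) (s := (Metric.thickening δ C)ᶜ)
    (t := Metric.cthickening (δ / 2) C) Metric.isOpen_thickening.isClosed_compl
    Metric.isClosed_cthickening
    (disjoint_compl_left_iff_subset.2
      (Metric.cthickening_subset_thickening' hδ (by linarith) C))
  have hχ : ContDiff ℝ 2 f := f.contMDiff.contDiff
  have hts : tsupport f ⊆ Metric.cthickening δ C := by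
    refine closure_minimal (fun w hw => ?_) Metric.isClosed_cthickening
    refine Metric.thickening_subset_cthickening _ _ ?_
    by_contra hcon
    exact hw (hf0 hcon)
  have hcs : HasCompactSupport f := hC.cthickening.of_isClosed_subset (isClosed_tsupport _) hts
  have hone : ∀ z ∈ C, ∀ w, ‖w - z‖ < δ / 2 → f w = 1 := fun z hz w hw =>
    hf1 (Metric.thickening_subset_cthickening _ _
      (Metric.mem_thickening_iff.2 ⟨z, hz, by rwa [dist_eq_norm]⟩))
  have hev : ∀ᶠ w in 𝓝 e, f w = 1 := by
    filter_upwards [Metric.ball_mem_nhds e (half_pos hδ)] with w hw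
    exact hone e heC w (by rwa [← dist_eq_norm])
  refine ⟨δ / 2, half_pos hδ, fun w => f w • θ w, fun w => f w • M w, ?_, ?_⟩
  · have hθ' : (fun w => f w • θ w) =ᶠ[𝓝 e] θ := by
      filter_upwards [hev] with w hw; rw [hw, one_smul]
    have hMe : f e • M e = M e := by rw [hev.self_of_nhds, one_smul]
    refine ⟨smul_cut G.hU G.hθ hχ (hts.trans hsub), hcs.smul_right,
      smul_cut G.hU G.hM hχ (hts.trans hsub), hcs.smul_right, ?_, ?_, G.hK, G.hc, ?_, G.hK2, ?_⟩
    · rw [G.hθe, smul_zero]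
    · rw [hMe, G.hMv]
    · rw [hθ'.fderiv_eq]; exact G.hJ
    · rw [hMe]; exact G.hM2
  · intro z hz w hw
    have h1 := hone z hz w hw
    refine ⟨hsub (Metric.thickening_subset_cthickening _ _
      (Metric.mem_thickening_iff.2 ⟨z, hz, ?_⟩)), ?_, ?_⟩
    · rw [dist_eq_norm]; linarith
    · simp [h1]
    · simp [h1]

lemma orbit_compact (G : Glob U θ M e v K c K2) {x : ℝ → E} (hx : SolX θ e x)
    (hm : ∀ t, 0 ≤ t → x t ∈ U) :
    ∃ C, IsCompact C ∧ C ⊆ U ∧ e ∈ C ∧ ∀ t, 0 ≤ t → x t ∈ C := by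
  have := FiniteDimensional.proper ℝ E
  obtain ⟨r, hr, hsub⟩ := Metric.nhds_basis_closedBall.mem_iff.1 (G.hU.mem_nhds G.he)
  obtain ⟨T, hT⟩ := eventually_atTop.1 (hx.lim.eventually (Metric.closedBall_mem_nhds e hr))
  refine ⟨x '' Icc 0 T ∪ Metric.closedBall e r, ?_, ?_, Or.inr (Metric.mem_closedBall_self hr.le),
    fun t ht => ?_⟩
  · exact (isCompact_Icc.image_of_continuousOn (hx.cont.mono Icc_subset_Ici_self)).union
      (isCompact_closedBall e r)
  · refine union_subset ?_ hsub
    rintro _ ⟨t, ht, rfl⟩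
    exact hm t ht.1
  · rcases le_total t T with h | h
    · exact Or.inl ⟨t, ⟨ht, h⟩, rfl⟩
    · exact Or.inr (hT t h)

lemma SolX.congr {θ' : E → E} {x : ℝ → E} (hx : SolX θ e x)
    (h : ∀ t, 0 ≤ t → θ' (x t) = θ (x t)) : SolX θ' e x :=
  ⟨fun t ht => by rw [h t ht]; exact hx.ode t ht, hx.lim⟩

lemma SolY.congr {M' : E → E →L[ℝ] E} {x x' y : ℝ → E} (hy : SolY M v x y)
    (h : ∀ t, 0 ≤ t → M' (x' t) = M (x t)) : SolY M' v x' y :=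
  ⟨fun t ht => by rw [h t ht]; exact hy.ode t ht, hy.lim⟩

lemma Sol.unique (G : Glob U θ M e v K c K2) {x y x' y' : ℝ → E} (h : Sol U θ M e v x y)
    (h' : Sol U θ M e v x' y') (h0 : x 0 = x' 0) {t : ℝ} (ht : 0 ≤ t) :
    x t = x' t ∧ y t = y' t := by
  obtain ⟨C1, hC1, hC1U, heC1, hx1⟩ := orbit_compact G h.sx h.mem
  obtain ⟨C2, hC2, hC2U, heC2, hx2⟩ := orbit_compact G h'.sx h'.mem
  obtain ⟨ε, hε, θ', M', S, hS⟩ := cutoff G (hC1.union hC2) (union_subset hC1U hC2U) (Or.inl heC1)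
  have hS' : ∀ z ∈ C1 ∪ C2, θ' z = θ z ∧ M' z = M z := fun z hz =>
    (hS z hz z (by simpa using hε)).2
  have hX := h.sx.congr (fun t ht => (hS' _ (Or.inl (hx1 t ht))).1)
  have hX' := h'.sx.congr (fun t ht => (hS' _ (Or.inr (hx2 t ht))).1)
  obtain ⟨L, hL⟩ := (S.hθ.of_le one_le_two).lipschitzWith_of_hasCompactSupport S.hθs one_ne_zero
  have hxx : ∀ t, 0 ≤ t → x t = x' t := by
    intro t ht
    refine ODE_solution_unique_of_mem_Icc_right (v := fun _ => θ') (s := fun _ => univ) (K := L)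
      (a := 0) (b := t) (fun _ _ => hL.lipschitzOnWith)
      (hX.cont.mono Icc_subset_Ici_self) (fun s hs => ?_) (fun _ _ => mem_univ _)
      (hX'.cont.mono Icc_subset_Ici_self) (fun s hs => ?_) (fun _ _ => mem_univ _) h0 ⟨ht, le_rfl⟩
    · exact (hX.ode s hs.1).mono (Ici_subset_Ici.2 hs.1)
    · exact (hX'.ode s hs.1).mono (Ici_subset_Ici.2 hs.1)
  refine ⟨hxx t ht, ?_⟩
  exact SolY.unique S hX (h.sy.congr (fun t ht => (hS' _ (Or.inl (hx1 t ht))).2))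
    (h'.sy.congr (fun t ht => by rw [hxx t ht, (hS' _ (Or.inr (hx2 t ht))).2])) ht

lemma Sol.local (G : Glob U θ M e v K c K2) {x : ℝ → E} (hx : SolX θ e x)
    (hm : ∀ t, 0 ≤ t → x t ∈ U) :
    ∃ Y : E → E, ContDiffAt ℝ 2 Y (x 0) ∧
      ∀ᶠ h in 𝓝 (x 0), ∃ X y, Sol U θ M e v X y ∧ X 0 = h ∧ y 0 = Y h := by
  obtain ⟨C, hC, hCU, heC, hxC⟩ := orbit_compact G hx hm
  obtain ⟨ε, hε, θ', M', S, hS⟩ := cutoff G hC hCU heC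
  have hX := hx.congr (θ' := θ') (fun t ht => (hS _ (hxC t ht) _ (by simpa using hε)).2.1)
  obtain ⟨X, Y, hY, hev⟩ := local_main S hX hε
  refine ⟨fun h => Y h 0, hY, ?_⟩
  filter_upwards [hev] with h ⟨h1, h2, h3, h4⟩
  have h5 := fun t ht => hS _ (hxC t ht) _ (h3 t ht)
  exact ⟨X h, Y h, ⟨fun t ht => (h5 t ht).1, h2.congr (fun t ht => (h5 t ht).2.1.symm),
    h4.congr (fun t ht => (h5 t ht).2.2.symm)⟩, h1, rfl⟩

lemma shift_deriv {x : ℝ → E} {x' : E} {s t : ℝ} (hs : 0 ≤ s)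
    (h : HasDerivWithinAt x x' (Ici 0) (t + s)) :
    HasDerivWithinAt (fun r => x (r + s)) x' (Ici 0) t := by
  have h1 : HasDerivWithinAt (fun r : ℝ => r + s) 1 (Ici 0) t :=
    (hasDerivWithinAt_id t _).add_const s
  have := HasDerivWithinAt.scomp (t' := Ici 0) (h := fun r : ℝ => r + s) t h h1 (fun r (hr : 0 ≤ r) => by
    change 0 ≤ r + s; linarith)
  simpa using! this

lemma Sol.shift {x y : ℝ → E} (h : Sol U θ M e v x y) {s : ℝ} (hs : 0 ≤ s) :
    Sol U θ M e v (fun t => x (t + s)) (fun t => y (t + s)) :=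
  ⟨fun t ht => h.mem _ (by linarith),
   ⟨fun t ht => shift_deriv hs (h.sx.ode _ (by linarith)),
    h.sx.lim.comp (tendsto_atTop_add_const_right _ _ tendsto_id)⟩,
   ⟨fun t ht => shift_deriv hs (h.sy.ode _ (by linarith)),
    h.sy.lim.comp (tendsto_atTop_add_const_right _ _ tendsto_id)⟩⟩

open Classical in
/-- The invariant (co)vector field. -/
noncomputable def Lam (U : Set E) (θ : E → E) (M : E → E →L[ℝ] E) (e v : E) (h : E) : E :=
  if H : ∃ p : (ℝ → E) × (ℝ → E), Sol U θ M e v p.1 p.2 ∧ p.1 0 = h then H.choose.2 0 else 0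

lemma Lam_eq (G : Glob U θ M e v K c K2) {x y : ℝ → E} (h : Sol U θ M e v x y) :
    Lam U θ M e v (x 0) = y 0 := by
  have H : ∃ p : (ℝ → E) × (ℝ → E), Sol U θ M e v p.1 p.2 ∧ p.1 0 = x 0 := ⟨(x, y), h, rfl⟩
  rw [Lam, dif_pos H]
  exact (Sol.unique G H.choose_spec.1 h H.choose_spec.2 le_rfl).2

/-- The extended domain of attraction. -/
def Dom (U : Set E) (θ : E → E) (M : E → E →L[ℝ] E) (e v : E) : Set E :=
  {h | ∃ x y, Sol U θ M e v x y ∧ x 0 = h}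

lemma Dom_open (G : Glob U θ M e v K c K2) : IsOpen (Dom U θ M e v) := by
  refine isOpen_iff_mem_nhds.2 ?_
  rintro _ ⟨x, y, h, rfl⟩
  obtain ⟨Y, hY, hev⟩ := Sol.local G h.sx h.mem
  filter_upwards [hev] with h ⟨X, y, h1, h2, h3⟩
  exact ⟨X, y, h1, h2⟩

lemma Lam_contDiffAt (G : Glob U θ M e v K c K2) {h : E} (hh : h ∈ Dom U θ M e v) :
    ContDiffAt ℝ 2 (Lam U θ M e v) h := by
  obtain ⟨x, y, h, rfl⟩ := hh
  obtain ⟨Y, hY, hev⟩ := Sol.local G h.sx h.mem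
  refine hY.congr_of_eventuallyEq ?_
  filter_upwards [hev] with h ⟨X, y, h1, h2, h3⟩
  rw [← h3, ← h2]
  exact Lam_eq G h1

lemma mem_Dom (G : Glob U θ M e v K c K2) {x : ℝ → E} (hx : SolX θ e x)
    (hm : ∀ t, 0 ≤ t → x t ∈ U) : ∃ y, Sol U θ M e v x y := by
  obtain ⟨Y, hY, hev⟩ := Sol.local G hx hm
  obtain ⟨X, y, h1, h2, h3⟩ := hev.self_of_nhds
  -- the trajectory through `x 0` is unique
  obtain ⟨C1, hC1, hC1U, heC1, hx1⟩ := orbit_compact G hx hm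
  obtain ⟨C2, hC2, hC2U, heC2, hx2⟩ := orbit_compact G h1.sx h1.mem
  obtain ⟨ε, hε, θ', M', S, hS⟩ := cutoff G (hC1.union hC2) (union_subset hC1U hC2U) (Or.inl heC1)
  have hS' : ∀ z ∈ C1 ∪ C2, θ' z = θ z ∧ M' z = M z := fun z hz =>
    (hS z hz z (by simpa using hε)).2
  have hX := hx.congr (fun t ht => (hS' _ (Or.inl (hx1 t ht))).1)
  have hX' := h1.sx.congr (fun t ht => (hS' _ (Or.inr (hx2 t ht))).1)
  obtain ⟨L, hL⟩ := (S.hθ.of_le one_le_two).lipschitzWith_of_hasCompactSupport S.hθs one_ne_zero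
  have hxx : ∀ t, 0 ≤ t → x t = X t := by
    intro t ht
    refine ODE_solution_unique_of_mem_Icc_right (v := fun _ => θ') (s := fun _ => univ) (K := L)
      (a := 0) (b := t) (fun _ _ => hL.lipschitzOnWith)
      (hX.cont.mono Icc_subset_Ici_self) (fun s hs => ?_) (fun _ _ => mem_univ _)
      (hX'.cont.mono Icc_subset_Ici_self) (fun s hs => ?_) (fun _ _ => mem_univ _) h2.symm
      ⟨ht, le_rfl⟩
    · exact (hX.ode s hs.1).mono (Ici_subset_Ici.2 hs.1)
    · exact (hX'.ode s hs.1).mono (Ici_subset_Ici.2 hs.1)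
  exact ⟨y, hm, hx, h1.sy.congr fun t ht => by rw [hxx t ht]⟩

lemma Lam_pde (G : Glob U θ M e v K c K2) {x y : ℝ → E} (h : Sol U θ M e v x y) :
    M (x 0) (Lam U θ M e v (x 0)) + fderiv ℝ (Lam U θ M e v) (x 0) (θ (x 0)) = 0 := by
  have h1 : ∀ s, 0 ≤ s → Lam U θ M e v (x s) = y s := fun s hs => by
    have := Lam_eq G (h.shift hs)
    simpa using this
  have h2 : HasFDerivAt (Lam U θ M e v) (fderiv ℝ (Lam U θ M e v) (x 0)) (x 0) :=
    ((Lam_contDiffAt G ⟨x, y, h, rfl⟩).differentiableAt (by norm_num)).hasFDerivAt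
  have h3 := h2.comp_hasDerivWithinAt 0 (h.sx.ode 0 le_rfl)
  have h4 : HasDerivWithinAt y (fderiv ℝ (Lam U θ M e v) (x 0) (θ (x 0))) (Ici 0) 0 :=
    h3.congr (fun s hs => (h1 s hs).symm) (h1 0 le_rfl).symm
  have h5 := (uniqueDiffOn_Ici (0 : ℝ) 0 self_mem_Ici).eq_deriv _ h4 (h.sy.ode 0 le_rfl)
  rw [h5, h1 0 le_rfl, add_neg_cancel]

end Global

end DensReg


namespace DensReg

open Set Filter Topology BoundedContinuousFunction MeasureTheory
open scoped NNReal


set_option linter.unusedSectionVars false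
set_option linter.unusedSimpArgs false

section Concrete

variable {q : ℕ}

lemma entry_contDiffOn {β : Fin q → Fin q → (Fin q → ℝ) → ℝ} {ρ : Fin q → (Fin q → ℝ) → ℝ}
    {U : Set (Fin q → ℝ)} (hβC : ∀ i j, ContDiffOn ℝ 2 (β i j) U)
    (hρC : ∀ i, ContDiffOn ℝ 2 (ρ i) U) (i j : Fin q) :
    ContDiffOn ℝ 2 (fun h => interactionMatrix q β ρ h i j) U := by
  unfold interactionMatrix
  by_cases hij : i = j
  · subst hij
    simpa using (hβC i i).sub (hρC i)
  · simpa [hij] using hβC j i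

/-- The transposed interaction matrix as a continuous linear map. -/
noncomputable def Mop (β : Fin q → Fin q → (Fin q → ℝ) → ℝ) (ρ : Fin q → (Fin q → ℝ) → ℝ)
    (h : Fin q → ℝ) : (Fin q → ℝ) →L[ℝ] (Fin q → ℝ) :=
  ∑ i, ∑ j, interactionMatrix q β ρ h j i •
    (ContinuousLinearMap.proj (R := ℝ) (φ := fun _ : Fin q => ℝ) j).smulRight
      (Pi.single i (1 : ℝ) : Fin q → ℝ)

lemma Mop_apply (β : Fin q → Fin q → (Fin q → ℝ) → ℝ) (ρ : Fin q → (Fin q → ℝ) → ℝ)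
    (h y : Fin q → ℝ) : Mop β ρ h y = (interactionMatrix q β ρ h).transpose.mulVec y := by
  funext k
  simp [Mop, ContinuousLinearMap.sum_apply, Finset.sum_apply, Matrix.mulVec, dotProduct,
    Pi.single_apply]

lemma Mop_contDiffOn {β : Fin q → Fin q → (Fin q → ℝ) → ℝ} {ρ : Fin q → (Fin q → ℝ) → ℝ}
    {U : Set (Fin q → ℝ)} (hβC : ∀ i j, ContDiffOn ℝ 2 (β i j) U)
    (hρC : ∀ i, ContDiffOn ℝ 2 (ρ i) U) : ContDiffOn ℝ 2 (Mop β ρ) U := by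
  unfold Mop
  exact ContDiffOn.sum fun i _ => ContDiffOn.sum fun j _ =>
    (entry_contDiffOn hβC hρC j i).smul contDiffOn_const

lemma density_contDiffOn {β : Fin q → Fin q → (Fin q → ℝ) → ℝ} {ρ : Fin q → (Fin q → ℝ) → ℝ}
    {U : Set (Fin q → ℝ)} (hβC : ∀ i j, ContDiffOn ℝ 2 (β i j) U)
    (hρC : ∀ i, ContDiffOn ℝ 2 (ρ i) U) : ContDiffOn ℝ 2 (densityField q β ρ) U := by
  refine contDiffOn_pi.2 fun i => ?_
  unfold densityField Matrix.mulVec dotProduct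
  exact ContDiffOn.sum fun j _ =>
    (entry_contDiffOn hβC hρC i j).mul (contDiff_apply ℝ ℝ j).contDiffOn

lemma pos_of_cooperative (a : ℝ → Matrix (Fin q) (Fin q) ℝ) (y : ℝ → Fin q → ℝ) (v : Fin q → ℝ)
    (hv : ∀ i, 0 < v i) (ha : ∀ i, ContinuousOn (fun t => a t i i) (Ici 0))
    (hoff : ∀ t, 0 ≤ t → ∀ i j, i ≠ j → 0 ≤ a t i j)
    (hy : ∀ t, 0 ≤ t → HasDerivWithinAt y (-((a t).mulVec (y t))) (Ici 0) t)
    (hlim : Tendsto y atTop (𝓝 v)) (i : Fin q) : 0 < y 0 i := by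
  have hyi : ∀ i, ∀ t, 0 ≤ t →
      HasDerivWithinAt (fun t => y t i) (-(∑ j, a t i j * y t j)) (Ici 0) t := fun i t ht =>
    (hasDerivWithinAt_pi.1 (hy t ht)) i
  have hyc : ∀ i, ContinuousOn (fun t => y t i) (Ici 0) := fun i t ht =>
    (hyi i t ht).continuousWithinAt
  have hev : ∀ᶠ t in atTop, ∀ i, 0 < y t i := by
    refine eventually_all.2 fun i => ?_
    exact (tendsto_pi_nhds.1 hlim i).eventually (lt_mem_nhds (hv i))
  obtain ⟨T0, hT0⟩ := eventually_atTop.1 hev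
  set T := max T0 0 with hT
  have hT' : ∀ t, T ≤ t → ∀ i, 0 < y t i := fun t ht => hT0 t ((le_max_left _ _).trans ht)
  have hTn : 0 ≤ T := le_max_right _ _
  by_contra hcon
  push Not at hcon
  set B := ⋃ i, {t | t ∈ Icc 0 T ∧ y t i ∈ Iic (0 : ℝ)} with hB
  have hBc : IsCompact B := by
    refine isCompact_iUnion fun i => ?_
    refine isCompact_Icc.of_isClosed_subset ?_ (fun t ht => ht.1)
    exact ((hyc i).mono Icc_subset_Ici_self).preimage_isClosed_of_isClosed isClosed_Icc isClosed_Iic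
  obtain ⟨s, hsB, hsm⟩ := hBc.exists_isGreatest ⟨0, mem_iUnion.2 ⟨i, ⟨le_rfl, hTn⟩, hcon⟩⟩
  obtain ⟨l, ⟨hs0, hsT⟩, hl⟩ := mem_iUnion.1 hsB
  have hpos : ∀ t, s < t → ∀ j, 0 < y t j := by
    intro t ht j
    by_contra hc
    push Not at hc
    rcases le_total t T with h | h
    · exact absurd (hsm (mem_iUnion.2 ⟨j, ⟨hs0.trans ht.le, h⟩, hc⟩)) (not_le.2 ht)
    · exact absurd (hT' t h j) (not_lt.2 hc)
  obtain ⟨k, hk⟩ := (isCompact_Icc (a := (0 : ℝ)) (b := T + 1)).exists_bound_of_continuousOn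
    ((ha l).mono Icc_subset_Ici_self)
  have hg : AntitoneOn (fun t => Real.exp (-k * t) * y t l) (Icc s (T + 1)) := by
    have hder : ∀ t ∈ Ioo s (T + 1), HasDerivAt (fun t => Real.exp (-k * t) * y t l)
        (Real.exp (-k * t) * (-k * 1) * y t l
          + Real.exp (-k * t) * (-(∑ j, a t l j * y t j))) t := by
      intro t ht
      have h1 : HasDerivAt (fun t : ℝ => Real.exp (-k * t)) (Real.exp (-k * t) * (-k * 1)) t :=
        ((hasDerivAt_id t).const_mul (-k)).exp
      exact h1.mul ((hyi l t (hs0.trans ht.1.le)).hasDerivAt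
        (Ici_mem_nhds (lt_of_le_of_lt hs0 ht.1)))
    refine antitoneOn_of_deriv_nonpos (convex_Icc _ _) ?_ ?_ ?_
    · refine ContinuousOn.mul (by fun_prop) ((hyc l).mono fun t ht => hs0.trans ht.1)
    · rw [interior_Icc]
      exact fun t ht => (hder t ht).differentiableAt.differentiableWithinAt
    · rw [interior_Icc]
      intro t ht
      rw [(hder t ht).deriv]
      have ht0 : 0 ≤ t := hs0.trans ht.1.le
      rw [← Finset.add_sum_erase _ _ (Finset.mem_univ l)]
      have h1 : 0 ≤ ∑ j ∈ Finset.univ.erase l, a t l j * y t j :=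
        Finset.sum_nonneg fun j hj => mul_nonneg (hoff t ht0 l j (Finset.ne_of_mem_erase hj).symm)
          (hpos t ht.1 j).le
      have h2 : -k ≤ a t l l := (abs_le.1 (hk t ⟨ht0, ht.2.le⟩)).1
      have h3 := hpos t ht.1 l
      have h4 := Real.exp_pos (-k * t)
      have h5 : 0 ≤ (a t l l + k) * y t l := mul_nonneg (by linarith) h3.le
      have h6 := mul_nonneg h4.le (add_nonneg h1 h5)
      nlinarith
  have h1 := hg ⟨le_rfl, by linarith⟩ ⟨by linarith, le_rfl⟩ (by linarith : s ≤ T + 1)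
  have h2 := mul_pos (Real.exp_pos (-k * (T + 1))) (hT' (T + 1) (by linarith) l)
  have h3 : Real.exp (-k * s) * y s l ≤ 0 :=
    mul_nonpos_of_nonneg_of_nonpos (Real.exp_pos _).le hl
  simp only at h1
  linarith

lemma inner_const (a : ℝ → Matrix (Fin q) (Fin q) ℝ) (x y : ℝ → Fin q → ℝ) (e v : Fin q → ℝ)
    (hx : ∀ t, 0 ≤ t → HasDerivWithinAt x ((a t).mulVec (x t)) (Ici 0) t)
    (hy : ∀ t, 0 ≤ t → HasDerivWithinAt y (-((a t).transpose.mulVec (y t))) (Ici 0) t)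
    (hxl : Tendsto x atTop (𝓝 e)) (hyl : Tendsto y atTop (𝓝 v)) :
    ∑ i, y 0 i * x 0 i = ∑ i, v i * e i := by
  have hd : ∀ t, 0 ≤ t → HasDerivWithinAt (fun t => ∑ i, y t i * x t i) 0 (Ici 0) t := by
    intro t ht
    have h1 := HasDerivWithinAt.fun_sum (u := Finset.univ) fun i (_ : i ∈ Finset.univ) =>
      ((hasDerivWithinAt_pi.1 (hy t ht)) i).mul ((hasDerivWithinAt_pi.1 (hx t ht)) i)
    refine h1.congr_deriv ?_
    have h2 : (a t).transpose.mulVec (y t) ⬝ᵥ x t = y t ⬝ᵥ (a t).mulVec (x t) := by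
      rw [Matrix.mulVec_transpose, Matrix.dotProduct_mulVec]
    rw [Finset.sum_add_distrib]
    simp only [dotProduct] at h2
    simp only [Pi.neg_apply, neg_mul, Finset.sum_neg_distrib, h2]
    ring
  have hc : ∀ t, 0 ≤ t → ∑ i, y t i * x t i = ∑ i, y 0 i * x 0 i := by
    intro t ht
    have := Convex.is_const_of_fderivWithin_eq_zero (𝕜 := ℝ) (f := fun t => ∑ i, y t i * x t i)
      (convex_Ici (0 : ℝ)) (fun s hs => (hd s hs).differentiableWithinAt) (fun s hs => by
        have := (hd s hs).hasFDerivWithinAt.fderivWithin (uniqueDiffOn_Ici (0 : ℝ) s hs)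
        rw [this]; ext; simp) (mem_Ici.2 ht) (mem_Ici.2 (le_refl (0 : ℝ)))
    exact this
  have hl : Tendsto (fun t => ∑ i, y t i * x t i) atTop (𝓝 (∑ i, v i * e i)) :=
    tendsto_finsetSum _ fun i _ => (tendsto_pi_nhds.1 hyl i).mul (tendsto_pi_nhds.1 hxl i)
  refine tendsto_nhds_unique (tendsto_const_nhds.congr' ?_) hl
  filter_upwards [eventually_ge_atTop 0] with t ht
  exact (hc t ht).symm

end Concrete

end DensReg


/-- Under the density-regulation assumptions, there exist an open
set `W ⊇ U_eq` (the region of attraction of `h_eq` for the flow `ψ_θ`) and a `C²`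
map `Λ : W → ℝ^q` which is componentwise strictly positive, with `Λ(h_eq) = v_eq`,
satisfying `A(h)ᵀ Λ(h) + [JΛ(h)] θ(h) = 0` and `⟨Λ(h), h⟩ = 1` for every
`h ∈ U_eq`. -/
theorem stmt_11 (q : ℕ) (hq : 1 ≤ q)
    (β : Fin q → Fin q → (Fin q → ℝ) → ℝ) (ρ : Fin q → (Fin q → ℝ) → ℝ)
    (U : Set (Fin q → ℝ)) (hU : IsOpen U)
    (hUorth : {h : Fin q → ℝ | ∀ i, 0 ≤ h i} ⊆ U)
    (hβC : ∀ i j, ContDiffOn ℝ 2 (β i j) U)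
    (hρC : ∀ i, ContDiffOn ℝ 2 (ρ i) U)
    (hβnn : ∀ i j, ∀ h : Fin q → ℝ, (∀ k, 0 ≤ h k) → 0 ≤ β i j h)
    (hρnn : ∀ i, ∀ h : Fin q → ℝ, (∀ k, 0 ≤ h k) → 0 ≤ ρ i h)
    (hβbdd : ∀ i j, BddAbove (β i j '' {h : Fin q → ℝ | ∀ k, 0 ≤ h k}))
    (heq : Fin q → ℝ) (heqnn : ∀ i, 0 ≤ heq i) (heqne : heq ≠ 0)
    (heqfix : densityField q β ρ heq = 0)
    (hstable : ∀ z : ℂ,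
      (Matrix.charpoly ((Matrix.of fun i j : Fin q =>
        fderiv ℝ (fun x => densityField q β ρ x i) heq (Pi.single j 1)).map
          Complex.ofReal)).IsRoot z → z.re < 0)
    (hIrred : ∀ S : Set (Fin q), S.Nonempty → S ≠ Set.univ →
      ∃ i ∈ S, ∃ j, j ∉ S ∧ interactionMatrix q β ρ heq i j ≠ 0)
    (hβan : ∀ i j, AnalyticAt ℝ (β i j) heq)
    (hρan : ∀ i, AnalyticAt ℝ (ρ i) heq)
    (veq : Fin q → ℝ) (hveqpos : ∀ i, 0 < veq i)
    (hveqnull : Matrix.vecMul veq (interactionMatrix q β ρ heq) = 0)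
    (hveqinner : ∑ i, veq i * heq i = 1)
    -- the global flow `ψ_θ` on the nonnegative orthant
    (ψ : (Fin q → ℝ) → ℝ → (Fin q → ℝ))
    (hψ0 : ∀ x : Fin q → ℝ, (∀ i, 0 ≤ x i) → ψ x 0 = x)
    (hψorth : ∀ x : Fin q → ℝ, (∀ i, 0 ≤ x i) → ∀ t : ℝ, 0 ≤ t → ∀ i, 0 ≤ ψ x t i)
    (hψode : ∀ x : Fin q → ℝ, (∀ i, 0 ≤ x i) → ∀ t : ℝ, 0 ≤ t →
      HasDerivWithinAt (ψ x) (densityField q β ρ (ψ x t)) (Set.Ici 0) t)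
    -- the region of attraction of `h_eq`
    (Ueq : Set (Fin q → ℝ))
    (hUeq : Ueq = {x : Fin q → ℝ | (∀ i, 0 ≤ x i) ∧
      Filter.Tendsto (fun t => ψ x t) Filter.atTop (nhds heq)}) :
    ∃ W : Set (Fin q → ℝ), IsOpen W ∧ Ueq ⊆ W ∧
      ∃ Λ : (Fin q → ℝ) → (Fin q → ℝ),
        ContDiffOn ℝ 2 Λ W ∧
        (∀ h ∈ W, ∀ i, 0 < Λ h i) ∧
        Λ heq = veq ∧
        (∀ h ∈ Ueq,
          (interactionMatrix q β ρ h).transpose.mulVec (Λ h)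
            + fderiv ℝ Λ h (densityField q β ρ h) = 0) ∧
        (∀ h ∈ Ueq, ∑ i, Λ h i * h i = 1) := by
  obtain ⟨K, c, hK, hc, hJ⟩ := DensReg.hurwitz q hq (fderiv ℝ (densityField q β ρ) heq)
    (Matrix.of fun i j : Fin q =>
        fderiv ℝ (fun x => densityField q β ρ x i) heq (Pi.single j 1)) (fun x => by
      have hdiff : DifferentiableAt ℝ (densityField q β ρ) heq :=
        ((DensReg.density_contDiffOn hβC hρC).contDiffAt
          (hU.mem_nhds (hUorth heqnn))).differentiableAt (by norm_num)
      funext i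
      have h1 : fderiv ℝ (fun x => densityField q β ρ x i) heq
          = (ContinuousLinearMap.proj i).comp (fderiv ℝ (densityField q β ρ) heq) :=
        ((hasFDerivAt_pi'.1 hdiff.hasFDerivAt) i).fderiv
      simp only [Matrix.mulVec, dotProduct, Matrix.of_apply, h1]
      have h2 := LinearMap.pi_apply_eq_sum_univ
        ((ContinuousLinearMap.proj (R := ℝ) (φ := fun _ : Fin q => ℝ) i).comp
          (fderiv ℝ (densityField q β ρ) heq) : (Fin q → ℝ) →ₗ[ℝ] ℝ) x
      refine h2.trans (Finset.sum_congr rfl fun j _ => ?_)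
      rw [smul_eq_mul, mul_comm]
      have h3 : (fun j' => if j = j' then (1 : ℝ) else 0) = Pi.single j 1 := by
        funext j'; simp [Pi.single_apply, eq_comm]
      rw [h3]; rfl) hstable
  have hMv : DensReg.Mop β ρ heq veq = 0 := by
    rw [DensReg.Mop_apply, Matrix.mulVec_transpose, hveqnull]
  have hoff : ∀ h : Fin q → ℝ, (∀ k, 0 ≤ h k) → ∀ i j, i ≠ j →
      0 ≤ (interactionMatrix q β ρ h).transpose i j := fun h hh i j hij => by
    simpa [interactionMatrix, hij.symm] using hβnn i j h hh
  obtain ⟨K2, hK2, hM2⟩ := DensReg.metzler (DensReg.Mop β ρ heq)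
    (interactionMatrix q β ρ heq).transpose (DensReg.Mop_apply β ρ heq) (hoff heq heqnn) veq
    hveqpos hMv
  have G : DensReg.Glob U (densityField q β ρ) (DensReg.Mop β ρ) heq veq K c K2 :=
    ⟨hU, hUorth heqnn, DensReg.density_contDiffOn hβC hρC, DensReg.Mop_contDiffOn hβC hρC,
      heqfix, hMv, hK, hc, hJ, hK2, hM2⟩
  set Λ := DensReg.Lam U (densityField q β ρ) (DensReg.Mop β ρ) heq veq with hΛ
  set W0 := DensReg.Dom U (densityField q β ρ) (DensReg.Mop β ρ) heq veq with hW0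
  have hW0o : IsOpen W0 := DensReg.Dom_open G
  have hΛc : ContinuousOn Λ W0 := fun h hh =>
    (DensReg.Lam_contDiffAt G hh).continuousAt.continuousWithinAt
  have hsol : ∀ h ∈ Ueq, ∃ y, DensReg.Sol U (densityField q β ρ) (DensReg.Mop β ρ) heq veq
      (ψ h) y ∧ ψ h 0 = h ∧ Λ h = y 0 ∧ (∀ i, 0 ≤ h i) := by
    intro h hh
    rw [hUeq] at hh
    obtain ⟨y, hy⟩ := DensReg.mem_Dom G ⟨hψode h hh.1, hh.2⟩
      (fun t ht => hUorth (hψorth h hh.1 t ht))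
    have h1 := DensReg.Lam_eq G hy
    rw [hψ0 h hh.1] at h1
    exact ⟨y, hy, hψ0 h hh.1, h1, hh.1⟩
  have hpos : ∀ h ∈ Ueq, ∀ i, 0 < Λ h i := by
    intro h hh i
    obtain ⟨y, hy, h0, hy0, hnn⟩ := hsol h hh
    rw [hy0]
    refine DensReg.pos_of_cooperative (fun t => (interactionMatrix q β ρ (ψ h t)).transpose) y veq
      hveqpos (fun i => ?_) (fun t ht => hoff _ (hψorth h hnn t ht)) (fun t ht => ?_) hy.sy.lim i
    · exact (DensReg.entry_contDiffOn hβC hρC i i).continuousOn.comp hy.sx.cont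
        (fun t ht => hy.mem t ht)
    · have := hy.sy.ode t ht
      rwa [DensReg.Mop_apply] at this
  refine ⟨W0 ∩ Λ ⁻¹' {z | ∀ i, 0 < z i}, ?_, fun h hh => ⟨?_, hpos h hh⟩, Λ, fun h hh => ?_,
    fun h hh => hh.2, ?_, fun h hh => ?_, fun h hh => ?_⟩
  · refine hΛc.isOpen_inter_preimage hW0o ?_
    simp only [Set.setOf_forall]
    exact isOpen_iInter_of_finite fun i => isOpen_lt continuous_const (continuous_apply i)
  · obtain ⟨y, hy, h0, -⟩ := hsol h hh
    exact ⟨ψ h, y, hy, h0⟩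
  · exact (DensReg.Lam_contDiffAt G hh.1).contDiffWithinAt
  · have hs : DensReg.Sol U (densityField q β ρ) (DensReg.Mop β ρ) heq veq
        (fun _ => heq) (fun _ => veq) :=
      ⟨fun _ _ => G.he,
       ⟨fun t _ => by rw [heqfix]; exact hasDerivWithinAt_const _ _ _, tendsto_const_nhds⟩,
       ⟨fun t _ => by rw [hMv, neg_zero]; exact hasDerivWithinAt_const _ _ _,
        tendsto_const_nhds⟩⟩
    exact DensReg.Lam_eq G hs
  · obtain ⟨y, hy, h0, hy0, hnn⟩ := hsol h hh
    have := DensReg.Lam_pde G hy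
    rwa [h0, DensReg.Mop_apply] at this
  · obtain ⟨y, hy, h0, hy0, hnn⟩ := hsol h hh
    have := DensReg.inner_const (fun t => interactionMatrix q β ρ (ψ h t)) (ψ h) y heq veq
      hy.sx.ode (fun t ht => by
        have := hy.sy.ode t ht
        rwa [DensReg.Mop_apply] at this) hy.sx.lim hy.sy.lim
    rw [hy0, ← hveqinner, ← this, h0]
end

section
/- Let θ, ψ_θ and h_eq be as in the density-regulation setting, and let U ⊆ ℝ^q_+ be a set with h_eq ∈ U that is ψ_θ-invariant (ψ_θ(h,t) ∈ U for all h ∈ U, t ≥ 0) and on which every point is attracted to h_eq (ψ_θ(h,t) → h_eq as t → ∞ for every h ∈ U). Suppose Λ is a continuously differentiable ℝ^q-valued function defined on an open neighborhood of U satisfying A(h)ᵀ Λ(h) + [JΛ(h)] θ(h) = 0 for all h ∈ U, and Λ(h_eq) = v_eq where ⟨v_eq, h_eq⟩ = 1. Then ⟨Λ(h), h⟩ = 1 for every h ∈ U. -/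
/-- Let `U ∋ h_eq` be a `ψ_θ`-invariant subset of the orthant on
which every point is attracted to `h_eq`.  If `Λ` is `C¹` on an open neighborhood of
`U`, satisfies `A(h)ᵀ Λ(h) + [JΛ(h)] θ(h) = 0` on `U`, and `Λ(h_eq) = v_eq` with
`⟨v_eq, h_eq⟩ = 1`, then `⟨Λ(h), h⟩ = 1` for every `h ∈ U`. -/
theorem stmt_12 (q : ℕ) (hq : 1 ≤ q)
    (β : Fin q → Fin q → (Fin q → ℝ) → ℝ) (ρ : Fin q → (Fin q → ℝ) → ℝ)
    (ψ : (Fin q → ℝ) → ℝ → (Fin q → ℝ))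
    (Uinv : Set (Fin q → ℝ))
    (hUsub : Uinv ⊆ {h : Fin q → ℝ | ∀ i, 0 ≤ h i})
    (heq : Fin q → ℝ) (heqU : heq ∈ Uinv)
    (heqfix : densityField q β ρ heq = 0)
    (hψ0 : ∀ h ∈ Uinv, ψ h 0 = h)
    (hψinv : ∀ h ∈ Uinv, ∀ t : ℝ, 0 ≤ t → ψ h t ∈ Uinv)
    (hψode : ∀ h ∈ Uinv, ∀ t : ℝ, 0 ≤ t →
      HasDerivWithinAt (ψ h) (densityField q β ρ (ψ h t)) (Set.Ici 0) t)
    (hattr : ∀ h ∈ Uinv, Filter.Tendsto (fun t => ψ h t) Filter.atTop (nhds heq))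
    (O : Set (Fin q → ℝ)) (hO : IsOpen O) (hUO : Uinv ⊆ O)
    (Λ : (Fin q → ℝ) → (Fin q → ℝ))
    (hΛC1 : ContDiffOn ℝ 1 Λ O)
    (hΛpde : ∀ h ∈ Uinv,
      (interactionMatrix q β ρ h).transpose.mulVec (Λ h)
        + fderiv ℝ Λ h (densityField q β ρ h) = 0)
    (veq : Fin q → ℝ) (hΛeq : Λ heq = veq)
    (hinner : ∑ i, veq i * heq i = 1) :
    ∀ h ∈ Uinv, ∑ i, Λ h i * h i = 1 := by
  intro h hh
  have key : ∀ t : ℝ, 0 ≤ t → HasDerivWithinAt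
      (fun t => ∑ i, Λ (ψ h t) i * ψ h t i) 0 (Set.Ici 0) t := by
    intro t ht
    have hU := hψinv h hh t ht
    have hd : HasFDerivAt Λ (fderiv ℝ Λ (ψ h t)) (ψ h t) :=
      ((hΛC1.contDiffAt (hO.mem_nhds (hUO hU))).differentiableAt (by simp)).hasFDerivAt
    have h1 := hψode h hh t ht
    have h2 := hd.comp_hasDerivWithinAt t h1
    have h3 := hasDerivWithinAt_pi.1 h1
    have h4 := hasDerivWithinAt_pi.1 h2
    have h5 := HasDerivWithinAt.fun_sum (u := Finset.univ) (fun i _ => (h4 i).mul (h3 i))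
    have hp := hΛpde _ hU
    have hz : fderiv ℝ Λ (ψ h t) (densityField q β ρ (ψ h t))
        = - (interactionMatrix q β ρ (ψ h t)).transpose.mulVec (Λ (ψ h t)) :=
      eq_neg_of_add_eq_zero_right hp
    rw [hz] at h5
    refine h5.congr_deriv ?_
    rw [Finset.sum_add_distrib]
    have e : Λ (ψ h t) ⬝ᵥ (interactionMatrix q β ρ (ψ h t)).mulVec (ψ h t)
        = (interactionMatrix q β ρ (ψ h t)).transpose.mulVec (Λ (ψ h t)) ⬝ᵥ ψ h t := by
      rw [Matrix.dotProduct_mulVec, Matrix.mulVec_transpose]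
    simp only [dotProduct] at e
    simp only [densityField, Function.comp, Pi.neg_apply, neg_mul, Finset.sum_neg_distrib]
    rw [e]
    ring
  have hconst : ∀ T : ℝ, 0 ≤ T → ∑ i, Λ (ψ h T) i * ψ h T i = ∑ i, Λ h i * h i := by
    intro T hT
    have := constant_of_has_deriv_right_zero (a := 0) (b := T)
      (f := fun t => ∑ i, Λ (ψ h t) i * ψ h t i)
      (fun t ht => (key t ht.1).continuousWithinAt.mono Set.Icc_subset_Ici_self)
      (fun t ht => (key t ht.1).mono (Set.Ici_subset_Ici.2 ht.1)) T ⟨hT, le_rfl⟩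
    simpa [hψ0 h hh] using this
  have hc : ContinuousAt Λ heq := (hΛC1.contDiffAt (hO.mem_nhds (hUO heqU))).continuousAt
  have ht := hattr h hh
  have hl : Filter.Tendsto (fun t => ∑ i, Λ (ψ h t) i * ψ h t i) Filter.atTop
      (nhds (∑ i, Λ heq i * heq i)) := by
    refine tendsto_finsetSum _ fun i _ => ?_
    exact (tendsto_pi_nhds.1 (hc.tendsto.comp ht) i).mul (tendsto_pi_nhds.1 ht i)
  rw [hΛeq, hinner] at hl
  refine tendsto_nhds_unique (tendsto_const_nhds.congr' ?_) hl
  filter_upwards [Filter.eventually_ge_atTop 0] with T hT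
  exact (hconst T hT).symm
end

section
/- Let U ⊆ ℝ^d, let ψ : U × [0,∞) → U be a jointly continuous semiflow (ψ(x,0) = x and ψ(x,t+s) = ψ(ψ(x,t),s) for all x ∈ U, s,t ≥ 0), and let x_eq ∈ U satisfy ψ(x_eq,t) = x_eq for all t and ψ(x,t) → x_eq as t → ∞ for every x ∈ U. Suppose there is δ₀ > 0 such that for every δ ∈ (0,δ₀) there exists a ψ-invariant set W_δ, open in U, with x_eq ∈ W_δ and the closure of W_δ contained in the open ball of radius δ around x_eq. Then the attraction is uniform on compact sets: for every compact K ⊆ U, limsup_{t→∞} sup_{x∈K} ‖ψ(x,t) − x_eq‖ = 0. -/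
/-- Let `ψ` be a jointly continuous semiflow on `U ⊆ ℝ^d` with a
fixed point `x_eq` attracting every point of `U`.  If for every sufficiently small
`δ > 0` there is a `ψ`-invariant set `W_δ`, open in `U`, containing `x_eq`, whose
closure lies in the ball of radius `δ` around `x_eq`, then the attraction is uniform
on every compact subset of `U`. -/
theorem stmt_13 (d : ℕ) (U : Set (EuclideanSpace ℝ (Fin d)))
    (ψ : EuclideanSpace ℝ (Fin d) → ℝ → EuclideanSpace ℝ (Fin d))
    (hmem : ∀ x ∈ U, ∀ t : ℝ, 0 ≤ t → ψ x t ∈ U)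
    (hcont : ContinuousOn (fun p : EuclideanSpace ℝ (Fin d) × ℝ => ψ p.1 p.2)
      (U ×ˢ Set.Ici 0))
    (h0 : ∀ x ∈ U, ψ x 0 = x)
    (hsemi : ∀ x ∈ U, ∀ s t : ℝ, 0 ≤ s → 0 ≤ t → ψ x (t + s) = ψ (ψ x t) s)
    (xeq : EuclideanSpace ℝ (Fin d)) (hxeqU : xeq ∈ U)
    (hfix : ∀ t : ℝ, 0 ≤ t → ψ xeq t = xeq)
    (hattr : ∀ x ∈ U, Filter.Tendsto (fun t => ψ x t) Filter.atTop (nhds xeq))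
    (δ₀ : ℝ) (hδ₀ : 0 < δ₀)
    (hW : ∀ δ : ℝ, 0 < δ → δ < δ₀ →
      ∃ W : Set (EuclideanSpace ℝ (Fin d)), W ⊆ U ∧ xeq ∈ W ∧
        (∃ O : Set (EuclideanSpace ℝ (Fin d)), IsOpen O ∧ W = U ∩ O) ∧
        closure W ⊆ Metric.ball xeq δ ∧
        ∀ x ∈ W, ∀ t : ℝ, 0 ≤ t → ψ x t ∈ W) :
    ∀ K : Set (EuclideanSpace ℝ (Fin d)), K ⊆ U → IsCompact K →
      TendstoUniformlyOn (fun t x => ψ x t) (fun _ => xeq) Filter.atTop K := by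
  intro K hKU hK
  rw [Metric.tendstoUniformlyOn_iff]
  intro ε hε
  obtain ⟨W, hWU, hxW, ⟨O, hO, hWO⟩, hcl, hinv⟩ :=
    hW (min ε (δ₀ / 2)) (lt_min hε (by linarith)) ((min_le_right _ _).trans_lt (by linarith))
  have key : ∀ᶠ t in Filter.atTop, ∀ x ∈ K, ψ x t ∈ W := by
    refine hK.induction_on (p := fun S => ∀ᶠ t in Filter.atTop, ∀ x ∈ S, ψ x t ∈ W) ?_ ?_ ?_ ?_
    · simp
    · intro s t hst h
      filter_upwards [h] with a ha x hx using ha x (hst hx)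
    · intro s t hs ht
      filter_upwards [hs, ht] with a ha hb x hx
      rcases hx with hx | hx
      · exact ha x hx
      · exact hb x hx
    · intro x hx
      have hxO : O ∈ nhds xeq := hO.mem_nhds (by rw [hWO] at hxW; exact hxW.2)
      obtain ⟨T, hT, hT0⟩ :=
        (((hattr x (hKU hx)).eventually hxO).and (Filter.eventually_ge_atTop 0)).exists
      have hc : ContinuousOn (fun y => ψ y T) U :=
        hcont.comp (f := fun y => (y, T)) (by fun_prop) (fun y hy => ⟨hy, hT0⟩)
      have h1 : ∀ᶠ y in nhdsWithin x K, ψ y T ∈ O :=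
        ((hc x (hKU hx)).mono hKU).eventually (hO.mem_nhds hT)
      refine ⟨_, Filter.inter_mem h1 self_mem_nhdsWithin, ?_⟩
      filter_upwards [Filter.eventually_ge_atTop T] with t ht y hy
      have hyU : y ∈ U := hKU hy.2
      have h2 : ψ y T ∈ W := by
        rw [hWO]
        exact ⟨hmem y hyU T hT0, hy.1⟩
      have h3 := hinv _ h2 (t - T) (by linarith)
      rwa [← hsemi y hyU (t - T) T (by linarith) hT0, add_sub_cancel] at h3
  filter_upwards [key] with t ht x hx
  have h := hcl (subset_closure (ht x hx))
  rw [Metric.mem_ball, dist_comm] at h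
  exact h.trans_le (min_le_left _ _)
end
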